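/- For every i ≥ 1 and every section-hyperbolic polynomial a_0 + a_1 x + ... + a_{i+1} x^{i+1} of degree i+1, one has a_i^2/(a_{i−1} a_{i+1}) ≥ A_i^2/(A_{i−1} A_{i+1}). In other words, the infimum m_i of a_i^2/(a_{i−1} a_{i+1}) over all section-hyperbolic polynomials of degree i+1 equals A_i^2/(A_{i−1} A_{i+1}) and is attained at the polynomial p_{i+1}. -/

import Mathlib

open Polynomial

/-- A real polynomial is hyperbolic if all of its complex roots are real. -/
def Hyperbolic (P : Polynomial ℝ) : Prop :=
  ∀ z : ℂ, Polynomial.aeval z P = 0 → z.im = 0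

/-- The `i`-th section `a_0 + a_1 x + ... + a_i x^i` of the coefficient sequence `a`. -/
noncomputable def sect (a : ℕ → ℝ) (i : ℕ) : Polynomial ℝ :=
  ∑ j ∈ Finset.range (i + 1), Polynomial.C (a j) * Polynomial.X ^ j

/-- A polynomial `a_0 + ... + a_n x^n` with all coefficients positive is section-hyperbolic
if each of its sections of degree `1,...,n` is hyperbolic. -/
def SectionHyperbolic (a : ℕ → ℝ) (n : ℕ) : Prop :=
  (∀ i ≤ n, 0 < a i) ∧ ∀ i, 1 ≤ i → i ≤ n → Hyperbolic (sect a i)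

/-- The coefficients of the extremal series: `A_0 = A_1 = 1` and `A_{n+2}` is the largest
(here: supremum of) positive `t` such that `p_{n+1}(x) + t x^{n+2}` is hyperbolic, where
`p_{n+1}(x) = Σ_{j=0}^{n+1} A_j x^j`. -/
noncomputable def Acoef : ℕ → ℝ
  | 0 => 1
  | 1 => 1
  | n + 2 =>
    sSup {t : ℝ | 0 < t ∧ Hyperbolic
      ((∑ j ∈ (Finset.range (n + 2)).attach, Polynomial.C (Acoef j.1) * Polynomial.X ^ (j.1 : ℕ)) +
        Polynomial.C t * Polynomial.X ^ (n + 2))}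
decreasing_by
  exact Finset.mem_range.mp j.2

/-! ### Hyperbolic polynomials -/

lemma Hyperbolic.splits {P : ℝ[X]} (h : Hyperbolic P) : P.Splits := by
  refine Splits.of_splits_map (algebraMap ℝ ℂ) (IsAlgClosed.splits _) fun z hz => ?_
  have hroot : aeval z P = 0 := by
    rw [aeval_def, ← eval_map]
    exact (mem_roots'.1 hz).2
  exact ⟨z.re, Complex.ext rfl (h z hroot).symm⟩

lemma Polynomial.Splits.hyperbolic {P : ℝ[X]} (hP : P.Splits) (h0 : P ≠ 0) : Hyperbolic P := by
  intro z hz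
  rw [hP.eq_prod_roots, map_mul, aeval_C, map_multiset_prod, Multiset.map_map] at hz
  rcases mul_eq_zero.1 hz with hz | hz
  · exact absurd (by simpa using hz) (leadingCoeff_ne_zero.2 h0)
  · obtain ⟨r, -, hr⟩ := Multiset.mem_map.1 (Multiset.prod_eq_zero_iff.1 hz)
    have hzr : z = (r : ℂ) := by simpa [sub_eq_zero] using hr
    simp [hzr]

lemma Hyperbolic.le_norm_aeval {P : ℝ[X]} (h : Hyperbolic P) (z : ℂ) :
    |P.leadingCoeff| * |z.im| ^ P.natDegree ≤ ‖aeval z P‖ := by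
  have hprod : ∀ s : Multiset ℝ,
      |z.im| ^ s.card ≤ ‖(s.map fun r : ℝ => z - (r : ℂ)).prod‖ := by
    intro s
    induction s using Multiset.induction_on with
    | empty => simp
    | cons r s ih =>
      have hr : |z.im| ≤ ‖z - (r : ℂ)‖ := by
        simpa using Complex.abs_im_le_norm (z - (r : ℂ))
      rw [Multiset.map_cons, Multiset.prod_cons, Multiset.card_cons, norm_mul, pow_succ, mul_comm]
      exact mul_le_mul hr ih (by positivity) (norm_nonneg _)
  have hev : aeval z P =
      (P.leadingCoeff : ℂ) * (P.roots.map fun r : ℝ => z - (r : ℂ)).prod := by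
    conv_lhs => rw [h.splits.eq_prod_roots, map_mul, aeval_C, map_multiset_prod, Multiset.map_map]
    simp
  rw [hev, norm_mul, Complex.norm_real, Real.norm_eq_abs, h.splits.natDegree_eq_card_roots]
  exact mul_le_mul_of_nonneg_left (hprod _) (abs_nonneg _)

/-- A polynomial of degree at most `n + 1` which alternates in sign along `n + 1` decreasing points
is hyperbolic. -/
lemma hyperbolic_of_alternating {P : ℝ[X]} {n : ℕ} (hdeg : P.natDegree ≤ n + 1) (u : ℕ → ℝ)
    (hu : ∀ k < n, u (k + 1) < u k) (hP : ∀ k ≤ n, 0 < (-1) ^ k * P.eval (u k)) :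
    Hyperbolic P := by
  have h0 : P ≠ 0 := by
    rintro rfl
    simpa using hP 0 (Nat.zero_le _)
  have hroot : ∀ k < n, ∃ r, u (k + 1) < r ∧ r < u k ∧ P.eval r = 0 := by
    intro k hk
    have h1 := hP k hk.le
    have h2 := hP (k + 1) hk
    have hc : ContinuousOn (fun x => (-1) ^ k * P.eval x) (Set.Icc (u (k + 1)) (u k)) := by
      fun_prop
    have h3 : (-1) ^ k * P.eval (u (k + 1)) < 0 := by
      rw [pow_succ] at h2
      linarith
    obtain ⟨r, hr, hr0⟩ := intermediate_value_Ioo (hu k hk).le hc ⟨h3, h1⟩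
    exact ⟨r, hr.1, hr.2, by simpa using hr0⟩
  choose! r hr1 hr2 hr3 using hroot
  have hmono : ∀ j k, j < k → k < n → r k < r j := by
    intro j k hjk
    induction k, hjk using Nat.le_induction with
    | base => exact fun hk => (hr2 _ hk).trans (hr1 _ (by omega))
    | succ k hjk ih =>
      exact fun hk => ((hr2 _ hk).trans (hr1 k (by omega))).trans (ih (by omega))
  have hinj : Set.InjOn r (Finset.range n) := by
    intro j hj k hk hjk
    simp only [Finset.coe_range, Set.mem_Iio] at hj hk
    rcases lt_trichotomy j k with h | h | h
    · exact absurd hjk (hmono j k h hk).ne'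
    · exact h
    · exact absurd hjk (hmono k j h hj).ne
  have hcard : n ≤ P.roots.card := by
    have hsub : ((Finset.range n).image r).val ⊆ P.roots := by
      intro x hx
      obtain ⟨k, hk, rfl⟩ := Finset.mem_image.1 (Finset.mem_val ▸ hx)
      exact (mem_roots h0).2 (hr3 k (Finset.mem_range.1 hk))
    have hle := Multiset.card_le_card
      ((Multiset.le_iff_subset ((Finset.range n).image r).nodup).2 hsub)
    rwa [Finset.card_val, Finset.card_image_of_injOn hinj, Finset.card_range] at hle
  obtain ⟨q, hq, hqdeg, -⟩ := exists_prod_multiset_X_sub_C_mul P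
  have hq1 : q.Splits := Splits.of_natDegree_le_one (by omega)
  refine Splits.hyperbolic ?_ h0
  rw [← hq]
  refine Splits.mul (Splits.multisetProd ?_) hq1
  intro f hf
  obtain ⟨a, -, rfl⟩ := Multiset.mem_map.1 hf
  exact Splits.X_sub_C a

/-! ### Sections -/

lemma eval_sect (a : ℕ → ℝ) (n : ℕ) (x : ℝ) :
    (sect a n).eval x = ∑ j ∈ Finset.range (n + 1), a j * x ^ j := by
  simp [sect, eval_finsetSum]

lemma coeff_sect (a : ℕ → ℝ) (n k : ℕ) : (sect a n).coeff k = if k ≤ n then a k else 0 := by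
  simp [sect, coeff_C_mul, coeff_X_pow]

lemma sect_congr {a b : ℕ → ℝ} {n : ℕ} (h : ∀ j ≤ n, a j = b j) : sect a n = sect b n := by
  ext k
  rw [coeff_sect, coeff_sect]
  split_ifs with hk
  · exact h k hk
  · rfl

lemma natDegree_sect_le (a : ℕ → ℝ) (n : ℕ) : (sect a n).natDegree ≤ n := by
  rw [natDegree_le_iff_coeff_eq_zero]
  intro k hk
  rw [coeff_sect, if_neg (by omega)]

lemma natDegree_sect {a : ℕ → ℝ} {n : ℕ} (h : a n ≠ 0) : (sect a n).natDegree = n :=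
  natDegree_eq_of_le_of_coeff_ne_zero (natDegree_sect_le a n) (by simpa [coeff_sect] using h)

lemma leadingCoeff_sect {a : ℕ → ℝ} {n : ℕ} (h : a n ≠ 0) : (sect a n).leadingCoeff = a n := by
  rw [leadingCoeff, natDegree_sect h, coeff_sect, if_pos le_rfl]

lemma sect_succ (a : ℕ → ℝ) (n : ℕ) : sect a (n + 1) = sect a n + C (a (n + 1)) * X ^ (n + 1) := by
  rw [sect, Finset.sum_range_succ, ← sect]

/-- The admissible top coefficients of a section form a set whose supremum is admissible. -/
lemma hyperbolic_sSup {p : ℝ[X]} {N : ℕ} (hp : p.natDegree ≤ N)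
    (hne : {t : ℝ | 0 < t ∧ Hyperbolic (p + C t * X ^ (N + 1))}.Nonempty)
    (hbd : BddAbove {t : ℝ | 0 < t ∧ Hyperbolic (p + C t * X ^ (N + 1))}) :
    let T := sSup {t : ℝ | 0 < t ∧ Hyperbolic (p + C t * X ^ (N + 1))}
    0 < T ∧ Hyperbolic (p + C T * X ^ (N + 1)) := by
  intro T
  have hpos : 0 < T := by
    obtain ⟨t, ht⟩ := hne
    exact ht.1.trans_le (le_csSup hbd ht)
  refine ⟨hpos, fun z hz => ?_⟩
  have hclosed : IsClosed {t : ℝ | t * |z.im| ^ (N + 1) ≤ ‖aeval z p + (t : ℂ) * z ^ (N + 1)‖} :=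
    isClosed_le (by fun_prop) (by fun_prop)
  have hsub : {t : ℝ | 0 < t ∧ Hyperbolic (p + C t * X ^ (N + 1))} ⊆
      {t : ℝ | t * |z.im| ^ (N + 1) ≤ ‖aeval z p + (t : ℂ) * z ^ (N + 1)‖} := by
    rintro t ⟨ht, hhyp⟩
    have hcoeff : (p + C t * X ^ (N + 1)).coeff (N + 1) = t := by
      simp [coeff_eq_zero_of_natDegree_lt (show p.natDegree < N + 1 by omega)]
    have hdeg : (p + C t * X ^ (N + 1)).natDegree = N + 1 := by
      refine natDegree_eq_of_le_of_coeff_ne_zero ?_ (by rw [hcoeff]; exact ht.ne')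
      exact natDegree_add_le_of_degree_le (by omega) (natDegree_C_mul_X_pow_le _ _)
    have hle := hhyp.le_norm_aeval z
    rw [leadingCoeff, hdeg, hcoeff, abs_of_pos ht] at hle
    simpa using hle
  have hT := hclosed.closure_subset_iff.2 hsub (csSup_mem_closure hne hbd)
  have hzero : aeval z p + (T : ℂ) * z ^ (N + 1) = 0 := by simpa using hz
  change T * |z.im| ^ (N + 1) ≤ ‖aeval z p + (T : ℂ) * z ^ (N + 1)‖ at hT
  rw [hzero, norm_zero] at hT
  have him : |z.im| ^ (N + 1) ≤ 0 := by
    by_contra hcon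
    exact absurd hT (not_le.2 (mul_pos hpos (not_le.1 hcon)))
  by_contra hcon
  exact absurd him (not_le.2 (pow_pos (abs_pos.2 hcon) _))

/-! ### Power sums of the roots -/

lemma Multiset.esymm_succ_cons (y : ℝ) (s : Multiset ℝ) (k : ℕ) :
    (y ::ₘ s).esymm (k + 1) = s.esymm (k + 1) + y * s.esymm k := by
  simp only [Multiset.esymm, Multiset.powersetCard_cons, Multiset.map_add, Multiset.sum_add,
    Multiset.map_map, Function.comp_def, Multiset.prod_cons, Multiset.sum_map_mul_left]

lemma Multiset.power_sums_eq_esymm (s : Multiset ℝ) :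
    s.sum = s.esymm 1 ∧ (s.map fun y => y ^ 2).sum = s.esymm 1 ^ 2 - 2 * s.esymm 2 ∧
      (s.map fun y => y ^ 3).sum =
        s.esymm 1 ^ 3 - 3 * s.esymm 1 * s.esymm 2 + 3 * s.esymm 3 := by
  induction s using Multiset.induction_on with
  | empty => simp [Multiset.esymm, Multiset.powersetCard_zero_right]
  | cons y s ih =>
    obtain ⟨h1, h2, h3⟩ := ih
    have h0 : s.esymm 0 = 1 := by simp [Multiset.esymm]
    simp only [Multiset.sum_cons, Multiset.map_cons, Multiset.esymm_succ_cons, h0, h1, h2, h3]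
    refine ⟨by ring, by ring, by ring⟩

/-- The Cauchy-Schwarz inequality for the second power sum of positive numbers. -/
lemma Multiset.sq_sum_sq_le {s : Multiset ℝ} (hs : ∀ y ∈ s, 0 < y) (h : 0 < s.sum) :
    (s.map fun y => y ^ 2).sum ^ 2 ≤ s.sum * (s.map fun y => y ^ 3).sum := by
  have key : ∀ l : ℝ, 0 ≤ (s.map fun y => y ^ 3).sum - 2 * l * (s.map fun y => y ^ 2).sum +
      l ^ 2 * s.sum := by
    intro l
    have hnn : 0 ≤ (s.map fun y => y * (y - l) ^ 2).sum :=
      Multiset.sum_nonneg (by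
        intro t ht
        obtain ⟨y, hy, rfl⟩ := Multiset.mem_map.1 ht
        have := hs y hy
        positivity)
    have heq : (s.map fun y => y * (y - l) ^ 2).sum = (s.map fun y => y ^ 3).sum -
        2 * l * (s.map fun y => y ^ 2).sum + l ^ 2 * s.sum := by
      clear hs h hnn
      induction s using Multiset.induction_on with
      | empty => simp
      | cons y s ih =>
        simp only [Multiset.map_cons, Multiset.sum_cons, ih]
        ring
    rwa [heq] at hnn
  have hk := key ((s.map fun y => y ^ 2).sum / s.sum)
  have hk2 := mul_nonneg hk h.le
  field_simp at hk2
  nlinarith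

lemma Multiset.exists_ge_sum_sq_div {s : Multiset ℝ} (hs : ∀ y ∈ s, 0 < y) (h : 0 < s.sum) :
    ∃ y ∈ s, (s.map fun y => y ^ 2).sum ≤ y * s.sum := by
  by_contra! hcon
  set p := (s.map fun y => y ^ 2).sum with hp
  have hle : ∀ t : Multiset ℝ, t ≤ s → t ≠ 0 → (t.map fun y => y ^ 2).sum * s.sum < p * t.sum := by
    intro t
    induction t using Multiset.induction_on with
    | empty => simp
    | cons y t ih =>
      intro hts _
      have hy : y ∈ s := Multiset.mem_of_le hts (Multiset.mem_cons_self y t)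
      have h1 : y ^ 2 * s.sum < p * y := by nlinarith [hcon y hy, hs y hy]
      rcases eq_or_ne t 0 with rfl | ht
      · simpa using h1
      · have := ih ((Multiset.le_cons_self t y).trans hts) ht
        simp only [Multiset.map_cons, Multiset.sum_cons]
        linarith
  have := hle s le_rfl (by rintro rfl; simp at h)
  exact absurd this (lt_irrefl _)

/-- The ratio `a_{m-1} a_{m+1} / a_m ^ 2`, with the convention that it vanishes for `m = 0`. -/
noncomputable def ratio (a : ℕ → ℝ) : ℕ → ℝ
  | 0 => 0
  | m + 1 => a m * a (m + 2) / a (m + 1) ^ 2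

lemma sect_neg_roots {a : ℕ → ℝ} {N : ℕ} (ha : ∀ j ≤ N, 0 < a j) (h : Hyperbolic (sect a N)) :
    ∃ s : Multiset ℝ, s.card = N ∧ (∀ y ∈ s, 0 < y ∧ (sect a N).eval (-y) = 0) ∧
      ∀ k ≤ N, a (N - k) = a N * s.esymm k := by
  have hN := ha N le_rfl
  have h0 : sect a N ≠ 0 := by
    intro h0
    have := leadingCoeff_sect hN.ne'
    rw [h0, leadingCoeff_zero] at this
    exact hN.ne this
  refine ⟨(sect a N).roots.map fun r => -r, ?_, ?_, ?_⟩
  · rw [Multiset.card_map, ← h.splits.natDegree_eq_card_roots, natDegree_sect hN.ne']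
  · intro y hy
    obtain ⟨r, hr, rfl⟩ := Multiset.mem_map.1 hy
    have hr0 : (sect a N).eval r = 0 := (mem_roots'.1 hr).2
    refine ⟨?_, by simpa using hr0⟩
    by_contra hcon
    have hrn : 0 ≤ r := by linarith
    rw [eval_sect, Finset.sum_range_succ'] at hr0
    have hnn : 0 ≤ ∑ k ∈ Finset.range N, a (k + 1) * r ^ (k + 1) :=
      Finset.sum_nonneg fun k hk =>
        mul_nonneg (ha _ (by have := Finset.mem_range.1 hk; omega)).le (pow_nonneg hrn _)
    have := ha 0 (Nat.zero_le _)
    simp at hr0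
    linarith
  · intro k hk
    have hcard : ((sect a N).roots.map fun r => -r).card = N := by
      rw [Multiset.card_map, ← h.splits.natDegree_eq_card_roots, natDegree_sect hN.ne']
    have hprod : sect a N = C (a N) *
        (((sect a N).roots.map fun r => -r).map fun r => X + C r).prod := by
      conv_lhs => rw [h.splits.eq_prod_roots, leadingCoeff_sect hN.ne']
      simp [Multiset.map_map, sub_eq_add_neg]
    have hc : (sect a N).coeff (N - k) = a (N - k) := by rw [coeff_sect, if_pos (by omega)]
    rw [← hc]
    conv_lhs => rw [hprod]
    rw [coeff_C_mul, Multiset.prod_X_add_C_coeff _ (by omega), hcard,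
      show N - (N - k) = k by omega]

/-- The moment inequalities for the roots of a section. -/
lemma Hyperbolic.ratio_bounds {a : ℕ → ℝ} {n : ℕ} (ha : ∀ j ≤ n + 2, 0 < a j)
    (h : Hyperbolic (sect a (n + 2))) :
    ratio a (n + 1) * (4 - 3 * ratio a n) ≤ 1 ∧
      ∃ y, (1 - 2 * ratio a (n + 1)) * (a (n + 1) / a (n + 2)) ≤ y ∧ 0 < y ∧
        (sect a (n + 2)).eval (-y) = 0 := by
  obtain ⟨s, hcard, hs, he⟩ := sect_neg_roots ha h
  have e1 := he 1 (by omega)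
  have e2 := he 2 (by omega)
  obtain ⟨p1, p2, p3⟩ := s.power_sums_eq_esymm
  simp only [show n + 2 - 1 = n + 1 by omega, show n + 2 - 2 = n by omega] at e1 e2
  have a0 := ha n (by omega)
  have a1 := ha (n + 1) (by omega)
  have a2 := ha (n + 2) (by omega)
  have he1 : s.esymm 1 = a (n + 1) / a (n + 2) := by rw [e1]; field_simp
  have hsum : 0 < s.sum := by rw [p1, he1]; positivity
  have he2 : s.esymm 2 = ratio a (n + 1) * s.esymm 1 ^ 2 := by
    rw [he1, ratio, e2]; field_simp
  have he3 : s.esymm 3 = ratio a (n + 1) ^ 2 * ratio a n * s.esymm 1 ^ 3 := by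
    rcases n with _ | n
    · have : s.esymm 3 = 0 := by
        rw [Multiset.esymm, Multiset.powersetCard_eq_empty 3 (by omega)]
        simp
      rw [this, ratio]
      ring
    · have e3 := he 3 (by omega)
      simp only [show n + 1 + 2 - 3 = n by omega] at e3
      rw [he1, ratio, ratio, e3]
      field_simp
  have hpos : 0 < s.esymm 1 := p1 ▸ hsum
  constructor
  · have hc := Multiset.sq_sum_sq_le (fun y hy => (hs y hy).1) hsum
    rw [p1, p2, p3, he3, he2] at hc
    have hr : 0 < ratio a (n + 1) := by rw [ratio]; positivity
    have h4 : 0 ≤ s.esymm 1 ^ 4 * (ratio a (n + 1) *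
        (1 - ratio a (n + 1) * (4 - 3 * ratio a n))) := by nlinarith
    have h5 := nonneg_of_mul_nonneg_right h4 (by positivity)
    linarith [nonneg_of_mul_nonneg_right h5 hr]
  · obtain ⟨y, hy, hle⟩ := Multiset.exists_ge_sum_sq_div (fun y hy => (hs y hy).1) hsum
    refine ⟨y, ?_, hs y hy⟩
    rw [p1, p2, he2] at hle
    rw [← he1]
    have : (1 - 2 * ratio a (n + 1)) * s.esymm 1 * s.esymm 1 ≤ y * s.esymm 1 := by nlinarith
    exact le_of_mul_le_mul_right this hpos

/-! ### Alternating sums attached to a sequence of ratios -/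

lemma alternating_sum_bounds (m : ℕ) : ∀ t : ℕ → ℝ, (∀ k, 0 ≤ t k) → (∀ k, t (k + 1) ≤ t k) →
    0 ≤ ∑ k ∈ Finset.range m, (-1) ^ k * t k ∧ ∑ k ∈ Finset.range m, (-1) ^ k * t k ≤ t 0 := by
  induction m with
  | zero => exact fun t h0 _ => ⟨by simp, by simpa using h0 0⟩
  | succ m ih =>
    intro t h0 h1
    obtain ⟨hl, hu⟩ := ih (fun k => t (k + 1)) (fun k => h0 _) (fun k => h1 _)
    have heq : ∑ k ∈ Finset.range (m + 1), (-1) ^ k * t k =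
        t 0 - ∑ k ∈ Finset.range m, (-1) ^ k * t (k + 1) := by
      rw [Finset.sum_range_succ']
      simp only [pow_succ, pow_zero, mul_neg, mul_one, neg_mul, Finset.sum_neg_distrib, one_mul]
      ring
    rw [heq]
    exact ⟨by linarith [h1 0], by linarith⟩

/-- Splitting off the first two terms of an alternating sum. -/
lemma alternating_sum_two (t : ℕ → ℝ) (m : ℕ) :
    ∑ k ∈ Finset.range (m + 2), (-1) ^ k * t k =
      t 0 - t 1 + ∑ k ∈ Finset.range m, (-1) ^ k * t (k + 2) := by
  induction m with
  | zero => simp [Finset.sum_range_succ]; ring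
  | succ m ih =>
    rw [show m + 1 + 2 = m + 2 + 1 by ring, Finset.sum_range_succ, ih, Finset.sum_range_succ,
      pow_add (-1 : ℝ) m 2]
    ring

/-- Splitting off the first four terms of an alternating sum. -/
lemma alternating_sum_four (t : ℕ → ℝ) (m : ℕ) :
    ∑ k ∈ Finset.range (m + 4), (-1) ^ k * t k =
      t 0 - t 1 + t 2 - t 3 + ∑ k ∈ Finset.range m, (-1) ^ k * t (k + 4) := by
  rw [alternating_sum_two t (m + 2), alternating_sum_two (fun k => t (k + 2)) m]
  ring

/-- The partial products `σ_0 ⋯ σ_{k-1}`. -/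
def partialProd (σ : ℕ → ℝ) : ℕ → ℝ
  | 0 => 1
  | k + 1 => partialProd σ k * σ k

/-- The coefficients with consecutive quotients `partialProd σ k`. -/
def ratioCoeff (σ : ℕ → ℝ) : ℕ → ℝ
  | 0 => 1
  | k + 1 => ratioCoeff σ k * partialProd σ k

/-- The alternating partial sum with coefficients `ratioCoeff σ`. -/
def altSum (σ : ℕ → ℝ) (x : ℝ) (m : ℕ) : ℝ :=
  ∑ k ∈ Finset.range m, (-1) ^ k * (ratioCoeff σ k * x ^ k)

section bounds

variable {σ : ℕ → ℝ}

lemma partialProd_nonneg (h : ∀ k, 0 ≤ σ k) (k : ℕ) : 0 ≤ partialProd σ k := by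
  induction k with
  | zero => exact zero_le_one
  | succ k ih => exact mul_nonneg ih (h k)

lemma ratioCoeff_nonneg (h : ∀ k, 0 ≤ σ k) (k : ℕ) : 0 ≤ ratioCoeff σ k := by
  induction k with
  | zero => exact zero_le_one
  | succ k ih => exact mul_nonneg ih (partialProd_nonneg h k)

lemma partialProd_succ_le (h : ∀ k, 0 ≤ σ k) (h' : ∀ k, σ k ≤ 1 / 3) (k : ℕ) :
    partialProd σ (k + 1) ≤ 1 / 3 := by
  induction k with
  | zero => simpa [partialProd] using h' 0
  | succ k ih =>
    have h1 := h' (k + 1)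
    have h2 := h (k + 1)
    have h3 := partialProd_nonneg h (k + 1)
    rw [partialProd]
    nlinarith

lemma ratioCoeff_succ_le (h : ∀ k, 0 ≤ σ k) (h' : ∀ k, σ k ≤ 1 / 3) (k : ℕ) :
    ratioCoeff σ (k + 2) ≤ ratioCoeff σ (k + 1) / 3 := by
  rw [ratioCoeff]
  have h1 := partialProd_succ_le h h' k
  have h2 := ratioCoeff_nonneg h (k + 1)
  nlinarith

lemma ratioCoeff_values (σ : ℕ → ℝ) : ratioCoeff σ 0 = 1 ∧ ratioCoeff σ 1 = 1 ∧
    ratioCoeff σ 2 = σ 0 ∧ ratioCoeff σ 3 = σ 0 ^ 2 * σ 1 ∧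
    ratioCoeff σ 4 = σ 0 ^ 3 * σ 1 ^ 2 * σ 2 := by
  simp only [ratioCoeff, partialProd]
  refine ⟨trivial, by ring, by ring, by ring, by ring⟩

lemma altSum_bounds (h : ∀ k, 0 ≤ σ k) (h' : ∀ k, σ k ≤ 1 / 3) {x : ℝ} (hx : 0 ≤ x) (hx1 : x ≤ 1)
    (m : ℕ) :
    1 - x + σ 0 * x ^ 2 - σ 0 ^ 2 * σ 1 * x ^ 3 ≤ altSum σ x (m + 4) ∧
      altSum σ x (m + 4) ≤ 1 - x + σ 0 * x ^ 2 - σ 0 ^ 2 * σ 1 * x ^ 3 +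
        σ 0 ^ 3 * σ 1 ^ 2 * σ 2 * x ^ 4 := by
  obtain ⟨c0, c1, c2, c3, c4⟩ := ratioCoeff_values σ
  have hb := alternating_sum_bounds m (fun k => ratioCoeff σ (k + 4) * x ^ (k + 4))
    (fun k => mul_nonneg (ratioCoeff_nonneg h _) (pow_nonneg hx _)) (fun k => by
      have h1 := ratioCoeff_succ_le h h' (k + 3)
      have h2 := ratioCoeff_nonneg h (k + 4)
      have h3 := ratioCoeff_nonneg h (k + 5)
      have h4 : x ^ (k + 5) ≤ x ^ (k + 4) := pow_le_pow_of_le_one hx hx1 (by omega)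
      exact mul_le_mul (by linarith) h4 (pow_nonneg hx _) h2)
  have heq := alternating_sum_four (fun k => ratioCoeff σ k * x ^ k) m
  simp only [c0, c1, c2, c3] at heq
  simp only [zero_add, c4] at hb
  rw [altSum, heq]
  constructor <;> nlinarith [hb.1, hb.2]

/-- Monotonicity of `x ↦ x * altSum σ x m` up to a point where the truncated derivative is
nonnegative. -/
lemma mul_altSum_le (h : ∀ k, 0 ≤ σ k) (h' : ∀ k, σ k ≤ 1 / 3) {x x' : ℝ} (hx : 0 ≤ x)
    (hxx : x ≤ x') (hx' : x' ≤ 1)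
    (hder : 0 ≤ 1 - 2 * x' + 3 * σ 0 * x' ^ 2 - 4 * (σ 0 ^ 2 * σ 1) * x' ^ 3) (m : ℕ) :
    x * altSum σ x (m + 4) ≤ x' * altSum σ x' (m + 4) := by
  obtain ⟨c0, c1, c2, c3, c4⟩ := ratioCoeff_values σ
  have hx'0 : 0 ≤ x' := hx.trans hxx
  have hd0 : ∀ k, 0 ≤ x' ^ (k + 1) - x ^ (k + 1) := fun k =>
    sub_nonneg.2 (pow_le_pow_left₀ hx hxx _)
  have hd1 : ∀ k, x' ^ (k + 2) - x ^ (k + 2) ≤ 2 * (x' ^ (k + 1) - x ^ (k + 1)) := by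
    intro k
    have e1 : x ^ k ≤ x' ^ k := pow_le_pow_left₀ hx hxx _
    have e2 : x ^ k * x * (x' - x) ≤ x ^ k * (x' - x) := by
      have : 0 ≤ x ^ k * (x' - x) := mul_nonneg (pow_nonneg hx _) (by linarith)
      nlinarith
    have e3 : x ^ k * (x' - x) ≤ x' ^ (k + 1) - x ^ (k + 1) := by
      rw [pow_succ, pow_succ]
      nlinarith
    have e4 : x' * (x' ^ (k + 1) - x ^ (k + 1)) ≤ x' ^ (k + 1) - x ^ (k + 1) := by
      nlinarith [hd0 k]
    have e5 : x' ^ (k + 2) - x ^ (k + 2) =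
        x' * (x' ^ (k + 1) - x ^ (k + 1)) + x ^ k * x * (x' - x) := by ring
    linarith
  have hb := alternating_sum_bounds m
    (fun k => ratioCoeff σ (k + 4) * (x' ^ (k + 5) - x ^ (k + 5)))
    (fun k => mul_nonneg (ratioCoeff_nonneg h _) (hd0 _)) (fun k => by
      have h1 := ratioCoeff_succ_le h h' (k + 3)
      have h2 := ratioCoeff_nonneg h (k + 4)
      have h3 := ratioCoeff_nonneg h (k + 5)
      have h4 := hd1 (k + 4)
      have h5 := hd0 (k + 4)
      calc ratioCoeff σ (k + 5) * (x' ^ (k + 6) - x ^ (k + 6))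
          ≤ ratioCoeff σ (k + 4) / 3 * (2 * (x' ^ (k + 5) - x ^ (k + 5))) :=
            mul_le_mul h1 h4 (hd0 (k + 5)) (by linarith)
        _ ≤ ratioCoeff σ (k + 4) * (x' ^ (k + 5) - x ^ (k + 5)) := by
            nlinarith [mul_nonneg h2 h5])
  have heq := alternating_sum_four (fun k => ratioCoeff σ k * (x' ^ (k + 1) - x ^ (k + 1))) m
  simp only [c0, c1, c2, c3] at heq
  have hdiff : x' * altSum σ x' (m + 4) - x * altSum σ x (m + 4) =
      ∑ k ∈ Finset.range (m + 4), (-1) ^ k * (ratioCoeff σ k * (x' ^ (k + 1) - x ^ (k + 1))) := by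
    rw [altSum, altSum, Finset.mul_sum, Finset.mul_sum, ← Finset.sum_sub_distrib]
    refine Finset.sum_congr rfl fun k _ => ?_
    ring
  have hK0 : 0 ≤ σ 0 ^ 2 * σ 1 := mul_nonneg (sq_nonneg _) (h 1)
  have hlin : 0 ≤ 1 - (x' + x) + σ 0 * (x' ^ 2 + x' * x + x ^ 2) -
      σ 0 ^ 2 * σ 1 * ((x' + x) * (x' ^ 2 + x ^ 2)) := by
    have f1 : (x' + x) * (x' ^ 2 + x ^ 2) ≤ 4 * x' ^ 3 := by
      have g1 : x ^ 2 ≤ x' ^ 2 := pow_le_pow_left₀ hx hxx _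
      calc (x' + x) * (x' ^ 2 + x ^ 2) ≤ (2 * x') * (2 * x' ^ 2) :=
            mul_le_mul (by linarith) (by linarith) (by positivity) (by linarith)
        _ = 4 * x' ^ 3 := by ring
    have f2 : σ 0 * (2 * x' ^ 2 - x' * x - x ^ 2) ≤ x' - x := by
      have : 2 * x' ^ 2 - x' * x - x ^ 2 = (x' - x) * (2 * x' + x) := by ring
      rw [this]
      have g2 : σ 0 * (2 * x' + x) ≤ 1 := by nlinarith [h 0, h' 0]
      nlinarith
    nlinarith [mul_le_mul_of_nonneg_left f1 hK0]
  have hfin := mul_nonneg (sub_nonneg.2 hxx) hlin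
  have htail : 0 ≤ ∑ k ∈ Finset.range m,
      (-1) ^ k * (ratioCoeff σ (k + 4) * (x' ^ (k + 4 + 1) - x ^ (k + 4 + 1))) := hb.1
  have : 0 ≤ x' * altSum σ x' (m + 4) - x * altSum σ x (m + 4) := by
    rw [hdiff, heq]
    refine add_nonneg (hfin.trans_eq ?_) htail
    ring
  linarith

end bounds

section comparison

variable {σ τ : ℕ → ℝ}

lemma partialProd_sub_succ (σ τ : ℕ → ℝ) (k : ℕ) :
    partialProd τ (k + 1) - partialProd σ (k + 1) =
      (partialProd τ k - partialProd σ k) * τ k + partialProd σ k * (τ k - σ k) := by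
  simp only [partialProd]
  ring

lemma ratioCoeff_sub_succ (σ τ : ℕ → ℝ) (k : ℕ) :
    ratioCoeff τ (k + 1) - ratioCoeff σ (k + 1) =
      (ratioCoeff τ k - ratioCoeff σ k) * partialProd τ k +
        ratioCoeff σ k * (partialProd τ k - partialProd σ k) := by
  simp only [ratioCoeff]
  ring

lemma partialProd_mono (h0 : ∀ k, 0 ≤ σ k) (h : ∀ k, σ k ≤ τ k) (k : ℕ) :
    partialProd σ k ≤ partialProd τ k := by
  induction k with
  | zero => exact le_rfl
  | succ k ih =>
    exact mul_le_mul ih (h k) (h0 k) (partialProd_nonneg (fun k => (h0 k).trans (h k)) k)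

lemma ratioCoeff_mono (h0 : ∀ k, 0 ≤ σ k) (h : ∀ k, σ k ≤ τ k) (k : ℕ) :
    ratioCoeff σ k ≤ ratioCoeff τ k := by
  induction k with
  | zero => exact le_rfl
  | succ k ih =>
    exact mul_le_mul ih (partialProd_mono h0 h k) (partialProd_nonneg h0 k)
      (ratioCoeff_nonneg (fun k => (h0 k).trans (h k)) k)

/-- Under the contraction hypothesis, the differences of coefficients decay. -/
lemma ratioCoeff_sub_succ_le (h0 : ∀ k, 0 ≤ σ k) (h : ∀ k, σ k ≤ τ k) {c : ℝ} (hc : 0 ≤ c)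
    (hcontr : ∀ k, σ k ^ 2 * (τ (k + 1) - σ (k + 1)) ≤ c * (τ k - σ k)) (k : ℕ) :
    ratioCoeff τ (k + 3) - ratioCoeff σ (k + 3) ≤
      (ratioCoeff τ (k + 2) - ratioCoeff σ (k + 2)) *
        (2 * partialProd τ (k + 2) + c * partialProd τ k) := by
  have hτ : ∀ k, 0 ≤ τ k := fun k => (h0 k).trans (h k)
  have P0 := partialProd_nonneg h0 k
  have P1 := partialProd_nonneg h0 (k + 1)
  have A1 := ratioCoeff_nonneg h0 (k + 1)
  have Q0 := partialProd_mono h0 h k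
  have Q1 := partialProd_mono h0 h (k + 1)
  have R1 := partialProd_nonneg hτ (k + 1)
  have D1 := ratioCoeff_mono h0 h (k + 1)
  have D2 := ratioCoeff_mono h0 h (k + 2)
  have eD2 := ratioCoeff_sub_succ σ τ (k + 1)
  have eD3 := ratioCoeff_sub_succ σ τ (k + 2)
  have eQ1 := partialProd_sub_succ σ τ k
  have eQ2 := partialProd_sub_succ σ τ (k + 1)
  set AQ := ratioCoeff σ (k + 1) * (partialProd τ (k + 1) - partialProd σ (k + 1)) with hAQ
  have hAQ0 : 0 ≤ AQ := mul_nonneg A1 (by linarith)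
  have hAQ1 : AQ ≤ ratioCoeff τ (k + 2) - ratioCoeff σ (k + 2) := by
    rw [eD2]
    have := mul_nonneg (sub_nonneg.2 D1) R1
    linarith
  have hA2 : ratioCoeff σ (k + 2) = ratioCoeff σ (k + 1) * partialProd σ (k + 1) := rfl
  have hP1 : partialProd σ (k + 1) = partialProd σ k * σ k := rfl
  have hR2 : partialProd τ (k + 2) = partialProd τ (k + 1) * τ (k + 1) := rfl
  have hmain : ratioCoeff σ (k + 2) * (partialProd τ (k + 2) - partialProd σ (k + 2)) ≤
      AQ * (partialProd τ (k + 2) + c * partialProd τ k) := by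
    have e1 : ratioCoeff σ (k + 2) * (partialProd τ (k + 2) - partialProd σ (k + 2)) =
        AQ * (partialProd σ (k + 1) * τ (k + 1)) + ratioCoeff σ (k + 1) * partialProd σ k ^ 2 *
          (σ k ^ 2 * (τ (k + 1) - σ (k + 1))) := by
      rw [eQ2, hA2, hAQ, hP1]
      ring
    have e2 : AQ * (partialProd σ (k + 1) * τ (k + 1)) ≤ AQ * partialProd τ (k + 2) := by
      rw [hR2]
      exact mul_le_mul_of_nonneg_left (mul_le_mul_of_nonneg_right Q1 (hτ _)) hAQ0
    have e3 : ratioCoeff σ (k + 1) * partialProd σ k ^ 2 * (σ k ^ 2 * (τ (k + 1) - σ (k + 1))) ≤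
        ratioCoeff σ (k + 1) * partialProd σ k ^ 2 * (c * (τ k - σ k)) :=
      mul_le_mul_of_nonneg_left (hcontr k) (by positivity)
    have e4 : ratioCoeff σ (k + 1) * (partialProd σ k * (τ k - σ k)) ≤ AQ := by
      rw [hAQ, eQ1]
      refine mul_le_mul_of_nonneg_left ?_ A1
      have := mul_nonneg (sub_nonneg.2 Q0) (hτ k)
      linarith
    have e5 : c * partialProd σ k * (ratioCoeff σ (k + 1) * (partialProd σ k * (τ k - σ k))) ≤
        c * partialProd τ k * AQ :=
      mul_le_mul (mul_le_mul_of_nonneg_left Q0 hc) e4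
        (mul_nonneg A1 (mul_nonneg P0 (sub_nonneg.2 (h k))))
        (mul_nonneg hc (P0.trans Q0))
    rw [e1]
    nlinarith
  have hR2n := partialProd_nonneg hτ (k + 2)
  have hR0n := partialProd_nonneg hτ k
  have hstep := mul_le_mul_of_nonneg_right hAQ1
    (show 0 ≤ partialProd τ (k + 2) + c * partialProd τ k by positivity)
  rw [eD3]
  nlinarith

/-- Lower bound for the difference of two alternating sums. -/
lemma altSum_sub_ge (h0 : ∀ k, 0 ≤ σ k) (h : ∀ k, σ k ≤ τ k) (hτ31 : ∀ k, τ k ≤ 31 / 100)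
    (hcontr : ∀ k, σ k ^ 2 * (τ (k + 1) - σ (k + 1)) ≤ 16 / 25 * (τ k - σ k)) {x : ℝ}
    (hx : 0 ≤ x) (hx1 : x ≤ 1) (m : ℕ) :
    (τ 0 - σ 0) * x ^ 2 - (τ 0 ^ 2 * τ 1 - σ 0 ^ 2 * σ 1) * x ^ 3 +
        23 / 25 * (τ 2 * (τ 0 ^ 3 * τ 1 ^ 2 - σ 0 ^ 3 * σ 1 ^ 2)) * x ^ 4 ≤
      altSum τ x (m + 6) - altSum σ x (m + 6) := by
  have hτ : ∀ k, 0 ≤ τ k := fun k => (h0 k).trans (h k)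
  have hτ3 : ∀ k, τ k ≤ 1 / 3 := fun k => (hτ31 k).trans (by norm_num)
  obtain ⟨c0, c1, c2, c3, c4⟩ := ratioCoeff_values σ
  obtain ⟨d0, d1, d2, d3, d4⟩ := ratioCoeff_values τ
  set D : ℕ → ℝ := fun k => ratioCoeff τ k - ratioCoeff σ k with hD
  have hD0 : ∀ k, 0 ≤ D k := fun k => sub_nonneg.2 (ratioCoeff_mono h0 h k)
  have hdec : ∀ k, D (k + 3) ≤ D (k + 2) := by
    intro k
    have h1 := ratioCoeff_sub_succ_le h0 h (by norm_num) hcontr k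
    have h2 : partialProd τ (k + 2) ≤ 31 / 100 * (31 / 100) := by
      have e0 : partialProd τ k ≤ 1 := by
        rcases k with _ | k
        · exact le_rfl
        · exact (partialProd_succ_le hτ hτ3 k).trans (by norm_num)
      have e1 : partialProd τ (k + 1) ≤ 1 * (31 / 100) :=
        mul_le_mul e0 (hτ31 k) (hτ k) zero_le_one
      exact mul_le_mul (by linarith) (hτ31 _) (hτ _) (by norm_num)
    have h3 : partialProd τ k ≤ 1 := by
      rcases k with _ | k
      · exact le_rfl
      · exact (partialProd_succ_le hτ hτ3 k).trans (by norm_num)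
    have h4 := hD0 (k + 2)
    refine h1.trans ?_
    exact mul_le_of_le_one_right h4 (by linarith)
  have hD5 : D 5 ≤ 2 / 25 * D 4 := by
    have h1 := ratioCoeff_sub_succ_le h0 h (by norm_num) hcontr 2
    have e1 : partialProd τ 1 ≤ 31 / 100 := by simpa [partialProd] using hτ31 0
    have e2 : partialProd τ 2 ≤ 31 / 100 * (31 / 100) :=
      mul_le_mul e1 (hτ31 1) (hτ _) (by norm_num)
    have e3 : partialProd τ 3 ≤ 31 / 100 * (31 / 100) * (31 / 100) :=
      mul_le_mul e2 (hτ31 _) (hτ _) (by norm_num)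
    have e4 : partialProd τ 4 ≤ 31 / 100 * (31 / 100) * (31 / 100) * (31 / 100) :=
      mul_le_mul e3 (hτ31 _) (hτ _) (by norm_num)
    have h4 := hD0 4
    refine h1.trans ?_
    rw [mul_comm (2 / 25)]
    exact mul_le_mul_of_nonneg_left (by norm_num at e4 e2 ⊢; linarith) h4
  have hb := alternating_sum_bounds m (fun k => D (k + 6) * x ^ (k + 6))
    (fun k => mul_nonneg (hD0 _) (pow_nonneg hx _)) (fun k =>
      mul_le_mul (hdec (k + 4)) (pow_le_pow_of_le_one hx hx1 (by omega)) (pow_nonneg hx _) (hD0 _))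
  have heq := alternating_sum_four (fun k => D k * x ^ k) (m + 2)
  have hdiff : altSum τ x (m + 6) - altSum σ x (m + 6) =
      ∑ k ∈ Finset.range (m + 2 + 4), (-1) ^ k * (D k * x ^ k) := by
    rw [altSum, altSum, ← Finset.sum_sub_distrib]
    refine Finset.sum_congr rfl fun k _ => ?_
    simp only [hD]
    ring
  have hpeel : ∑ k ∈ Finset.range (m + 2), (-1) ^ k * (D (k + 4) * x ^ (k + 4)) =
      D 4 * x ^ 4 - D 5 * x ^ 5 +
        ∑ k ∈ Finset.range m, (-1) ^ k * (D (k + 6) * x ^ (k + 6)) :=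
    alternating_sum_two (fun k => D (k + 4) * x ^ (k + 4)) m
  have h4 : D 5 * x ^ 5 ≤ 2 / 25 * D 4 * x ^ 4 :=
    mul_le_mul hD5 (pow_le_pow_of_le_one hx hx1 (by omega)) (pow_nonneg hx _)
      (mul_nonneg (by norm_num) (hD0 4))
  have hD4 : τ 2 * (τ 0 ^ 3 * τ 1 ^ 2 - σ 0 ^ 3 * σ 1 ^ 2) ≤ D 4 := by
    simp only [hD, c4, d4]
    have : σ 0 ^ 3 * σ 1 ^ 2 * σ 2 ≤ σ 0 ^ 3 * σ 1 ^ 2 * τ 2 :=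
      mul_le_mul_of_nonneg_left (h 2) (mul_nonneg (pow_nonneg (h0 0) _) (sq_nonneg _))
    linarith
  have hD4x := mul_le_mul_of_nonneg_right hD4 (pow_nonneg hx 4)
  have hb1 := hb.1
  have v0 : D 0 = 0 := by simp only [hD, c0, d0, sub_self]
  have v1 : D 1 = 0 := by simp only [hD, c1, d1, sub_self]
  have v2 : D 2 = τ 0 - σ 0 := by simp only [hD, c2, d2]
  have v3 : D 3 = τ 0 ^ 2 * τ 1 - σ 0 ^ 2 * σ 1 := by simp only [hD, c3, d3]
  rw [hdiff, heq, hpeel]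
  simp only [v0, v1, v2, v3]
  linarith

end comparison

/-! ### Sections as alternating sums -/

/-- The ratios below the index `n`, read downwards. -/
def downRatio (s : ℕ → ℝ) (n i : ℕ) : ℝ := s (n - 1 - i)

/-- The ratios above the index `k` and up to the index `n`. -/
def upRatio (s : ℕ → ℝ) (k n i : ℕ) : ℝ := if k + 1 + i ≤ n then s (k + 1 + i) else 0

lemma ratio_pos {a : ℕ → ℝ} {m : ℕ} (ha : ∀ j ≤ m + 2, 0 < a j) : 0 < ratio a (m + 1) := by
  have h0 := ha m (by omega)
  have h1 := ha (m + 1) (by omega)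
  have h2 := ha (m + 2) (by omega)
  rw [ratio]
  positivity

lemma coeff_down {a : ℕ → ℝ} {N : ℕ} (ha : ∀ j ≤ N + 1, 0 < a j) (k : ℕ) (hk : k ≤ N) :
    a (N - k) = a (N + 1 - k) * (a N / a (N + 1) *
      partialProd (downRatio (ratio a) (N + 1)) k) ∧
    a (N + 1 - k) = a (N + 1) * (a N / a (N + 1)) ^ k *
      ratioCoeff (downRatio (ratio a) (N + 1)) k := by
  induction k with
  | zero =>
    have h1 := ha (N + 1) le_rfl
    simp only [partialProd, ratioCoeff, Nat.sub_zero]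
    constructor
    · field_simp
    · ring
  | succ k ih =>
    obtain ⟨ih1, ih2⟩ := ih (by omega)
    obtain ⟨j, rfl⟩ : ∃ j, N = j + 1 + k := ⟨N - 1 - k, by omega⟩
    have e1 : j + 1 + k - k = j + 1 := by omega
    have e2 : j + 1 + k + 1 - k = j + 2 := by omega
    have e3 : j + 1 + k - (k + 1) = j := by omega
    have e4 : j + 1 + k + 1 - (k + 1) = j + 1 := by omega
    have e5 : j + 1 + k + 1 - 1 - k = j + 1 := by omega
    rw [e1, e2] at ih1
    rw [e2] at ih2
    rw [e3, e4]
    have h0 := ha j (by omega)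
    have h1 := ha (j + 1) (by omega)
    have h2 := ha (j + 2) (by omega)
    constructor
    · have hd : downRatio (ratio a) (j + 1 + k + 1) k = a j * a (j + 2) / a (j + 1) ^ 2 := by
        rw [downRatio, e5, ratio]
      rw [partialProd, hd]
      calc a j = a (j + 1) * (a (j + 1) / a (j + 2)) * (a j * a (j + 2) / a (j + 1) ^ 2) := by
            field_simp
        _ = _ := by
            nth_rewrite 2 [ih1]
            field_simp
    · rw [ratioCoeff, ih1]
      nth_rewrite 1 [ih2]
      ring

lemma ratioCoeff_eq_zero {σ : ℕ → ℝ} {j k : ℕ} (hj : σ j = 0) (hk : j + 2 ≤ k) :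
    ratioCoeff σ k = 0 := by
  have hp : partialProd σ (k - 1) = 0 := by
    obtain ⟨i, rfl⟩ : ∃ i, k = j + 2 + i := ⟨k - (j + 2), by omega⟩
    rw [show j + 2 + i - 1 = j + 1 + i by omega]
    clear hk
    induction i with
    | zero => rw [add_zero, partialProd, hj, mul_zero]
    | succ i ih => rw [← add_assoc, partialProd, ih, zero_mul]
  obtain ⟨i, rfl⟩ : ∃ i, k = i + 1 := ⟨k - 1, by omega⟩
  rw [ratioCoeff, show partialProd σ i = 0 from hp, mul_zero]

lemma sum_down {a : ℕ → ℝ} {N : ℕ} (ha : ∀ j ≤ N + 1, 0 < a j) {y : ℝ} (hy : 0 < y) (m : ℕ) :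
    ∑ j ∈ Finset.range (N + 2), a j * (-y) ^ j = (-1) ^ (N + 1) * (a (N + 1) * y ^ (N + 1)) *
      altSum (downRatio (ratio a) (N + 1)) (a N / a (N + 1) / y) (N + 2 + m) := by
  have hz : ∀ k, N + 2 ≤ k → ratioCoeff (downRatio (ratio a) (N + 1)) k = 0 := fun k hk =>
    ratioCoeff_eq_zero (j := N) (by simp [downRatio, ratio]) hk
  have htail : altSum (downRatio (ratio a) (N + 1)) (a N / a (N + 1) / y) (N + 2 + m) =
      altSum (downRatio (ratio a) (N + 1)) (a N / a (N + 1) / y) (N + 2) := by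
    rw [altSum, altSum]
    refine (Finset.sum_subset (Finset.range_mono (by omega)) fun k _ hk => ?_).symm
    rw [hz k (by simpa using hk)]
    ring
  rw [htail, altSum, Finset.mul_sum, ← Finset.sum_range_reflect]
  refine Finset.sum_congr rfl fun k hk => ?_
  have hk' : k ≤ N + 1 := by have := Finset.mem_range.1 hk; omega
  rw [show N + 2 - 1 - k = N + 1 - k by omega]
  have hc : a (N + 1 - k) = a (N + 1) * (a N / a (N + 1)) ^ k *
      ratioCoeff (downRatio (ratio a) (N + 1)) k := by
    rcases hk'.lt_or_eq with h | rfl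
    · exact (coeff_down ha k (by omega)).2
    · have h1 := (coeff_down ha N le_rfl).1
      have h2 := (coeff_down ha N le_rfl).2
      rw [show N + 1 - (N + 1) = N - N by omega, h1, ratioCoeff, h2]
      ring
  rw [hc]
  have hsign : (-1 : ℝ) ^ (N + 1 - k) = (-1) ^ (N + 1) * (-1) ^ k := by
    rw [← pow_sub_mul_pow (-1 : ℝ) hk', mul_assoc, ← mul_pow]
    simp
  have hypow : y ^ (N + 1) = y ^ (N + 1 - k) * y ^ k := (pow_sub_mul_pow y hk').symm
  rw [neg_pow, hsign, hypow, div_pow _ y]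
  field_simp

lemma coeff_up {a : ℕ → ℝ} {k n : ℕ} (ha : ∀ j ≤ n + 1, 0 < a j) (m : ℕ) (hm : k + m ≤ n) :
    a (k + m + 1) = a (k + m) * (a (k + 1) / a k * partialProd (upRatio (ratio a) k n) m) ∧
    a (k + m) = a k * (a (k + 1) / a k) ^ m * ratioCoeff (upRatio (ratio a) k n) m := by
  induction m with
  | zero =>
    have h1 := ha k (by omega)
    simp only [partialProd, ratioCoeff, add_zero]
    constructor
    · field_simp
    · ring
  | succ m ih =>
    obtain ⟨ih1, ih2⟩ := ih (by omega)
    have h0 := ha (k + m) (by omega)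
    have h1 := ha (k + m + 1) (by omega)
    rw [show k + (m + 1) = k + m + 1 by ring]
    constructor
    · have hd : upRatio (ratio a) k n m = a (k + m) * a (k + m + 2) / a (k + m + 1) ^ 2 := by
        rw [upRatio, if_pos (by omega), show k + 1 + m = k + m + 1 by ring, ratio]
      rw [partialProd, hd]
      calc a (k + m + 1 + 1) = a (k + m + 1) * (a (k + m + 1) / a (k + m)) *
            (a (k + m) * a (k + m + 2) / a (k + m + 1) ^ 2) := by
            field_simp
        _ = _ := by
            nth_rewrite 2 [ih1]
            field_simp
    · rw [ratioCoeff, ih1]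
      nth_rewrite 1 [ih2]
      ring

lemma sum_up {a : ℕ → ℝ} {k d : ℕ} (ha : ∀ j ≤ k + d + 1, 0 < a j) (y : ℝ) (m : ℕ) :
    ∑ j ∈ Finset.range (d + 2), a (k + j) * (-y) ^ (k + j) = (-1) ^ k * (a k * y ^ k) *
      altSum (upRatio (ratio a) k (k + d)) (a (k + 1) / a k * y) (d + 2 + m) := by
  have hz : ∀ j, d + 2 ≤ j → ratioCoeff (upRatio (ratio a) k (k + d)) j = 0 := fun j hj =>
    ratioCoeff_eq_zero (j := d) (by rw [upRatio, if_neg (by omega)]) hj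
  have htail : altSum (upRatio (ratio a) k (k + d)) (a (k + 1) / a k * y) (d + 2 + m) =
      altSum (upRatio (ratio a) k (k + d)) (a (k + 1) / a k * y) (d + 2) := by
    rw [altSum, altSum]
    refine (Finset.sum_subset (Finset.range_mono (by omega)) fun k _ hk => ?_).symm
    rw [hz k (by simpa using hk)]
    ring
  rw [htail, altSum, Finset.mul_sum]
  refine Finset.sum_congr rfl fun j hj => ?_
  have hj' : j ≤ d + 1 := by have := Finset.mem_range.1 hj; omega
  have hc : a (k + j) = a k * (a (k + 1) / a k) ^ j *
      ratioCoeff (upRatio (ratio a) k (k + d)) j := by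
    rcases hj'.lt_or_eq with h | rfl
    · exact (coeff_up ha j (by omega)).2
    · have h1 := (coeff_up ha d le_rfl).1
      have h2 := (coeff_up ha d le_rfl).2
      rw [← add_assoc, h1, ratioCoeff, h2]
      ring
  rw [hc, neg_pow, pow_add, pow_add, mul_pow]
  ring

/-- The value of a section in terms of the two ratio expansions around the index `N + 1`. -/
lemma eval_sect_two_sided {a : ℕ → ℝ} {N d : ℕ} (ha : ∀ j ≤ N + 1 + d + 1, 0 < a j) {y : ℝ}
    (hy : 0 < y) (m m' : ℕ) :
    (-1) ^ (N + 1) * (sect a (N + 1 + d + 1)).eval (-y) = a (N + 1) * y ^ (N + 1) *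
      (altSum (downRatio (ratio a) (N + 1)) (a N / a (N + 1) / y) (N + 2 + m) +
        altSum (upRatio (ratio a) (N + 1) (N + 1 + d)) (a (N + 2) / a (N + 1) * y) (d + 2 + m')
        - 1) := by
  have hd := sum_down (N := N) (fun j hj => ha j (by omega)) hy m
  have hu := sum_up (k := N + 1) (d := d) ha y m'
  have hsplit : (sect a (N + 1 + d + 1)).eval (-y) =
      ∑ j ∈ Finset.range (N + 2), a j * (-y) ^ j +
      ∑ j ∈ Finset.range (d + 2), a (N + 1 + j) * (-y) ^ (N + 1 + j) -
        a (N + 1) * (-y) ^ (N + 1) := by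
    rw [eval_sect, show N + 1 + d + 1 + 1 = N + 1 + (d + 2) by ring, Finset.sum_range_add,
      Finset.sum_range_succ _ (N + 1)]
    ring
  have hsq : ((-1 : ℝ) ^ (N + 1)) * (-1) ^ (N + 1) = 1 := by
    rw [← mul_pow]
    simp
  rw [hsplit, hd, hu, neg_pow]
  linear_combination (a (N + 1) * y ^ (N + 1) *
      (altSum (downRatio (ratio a) (N + 1)) (a N / a (N + 1) / y) (N + 2 + m) +
        altSum (upRatio (ratio a) (N + 1) (N + 1 + d)) (a (N + 2) / a (N + 1) * y) (d + 2 + m')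
        - 1)) * hsq

lemma altSum_two (σ : ℕ → ℝ) (x : ℝ) : altSum σ x 2 = 1 - x := by
  simp [altSum, Finset.sum_range_succ, ratioCoeff, partialProd]
  ring

/-- The value of a section of degree `N + 2` in terms of the expansion around `N + 1`. -/
lemma eval_sect_top {a : ℕ → ℝ} {N : ℕ} (ha : ∀ j ≤ N + 2, 0 < a j) {y : ℝ} (hy : 0 < y) :
    (-1) ^ (N + 1) * (sect a (N + 2)).eval (-y) = a (N + 1) * y ^ (N + 1) *
      (altSum (downRatio (ratio a) (N + 1)) (a N / a (N + 1) / y) (N + 7) -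
        a (N + 2) / a (N + 1) * y) := by
  have h := eval_sect_two_sided (N := N) (d := 0) ha hy 5 0
  rw [altSum_two] at h
  simp only [add_zero] at h
  rw [h]
  ring

/-! ### The largest root and the sampling criterion -/

/-- A section with all roots real yields a solution of `ratio a n = x * altSum _ x _`, with `x`
not too large. -/
lemma Hyperbolic.exists_root {a : ℕ → ℝ} {N : ℕ} (ha : ∀ j ≤ N + 2, 0 < a j)
    (h : Hyperbolic (sect a (N + 2))) (hN : ratio a N ≤ 31 / 100) :
    ratio a (N + 1) ≤ 100 / 307 ∧ ∃ x, 0 < x ∧ x ≤ 15 / 16 ∧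
      ratio a (N + 1) = x * altSum (downRatio (ratio a) (N + 1)) x (N + 7) := by
  obtain ⟨h1, y, hy, hy0, hroot⟩ := h.ratio_bounds ha
  have hpos := ratio_pos ha
  have hle : ratio a (N + 1) ≤ 100 / 307 := by nlinarith
  refine ⟨hle, a N / a (N + 1) / y, ?_, ?_, ?_⟩
  · have := ha N (by omega)
    have := ha (N + 1) (by omega)
    positivity
  · have a0 := ha N (by omega)
    have a1 := ha (N + 1) (by omega)
    have a2 := ha (N + 2) (by omega)
    have e1 : a N / a (N + 1) = ratio a (N + 1) * (a (N + 1) / a (N + 2)) := by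
      rw [ratio]
      field_simp
    rw [div_le_iff₀ hy0, e1]
    have e2 : 0 < a (N + 1) / a (N + 2) := by positivity
    have e3 : ratio a (N + 1) ≤ 15 / 16 * (1 - 2 * ratio a (N + 1)) := by
      norm_num at hle ⊢
      linarith
    nlinarith
  · have e := eval_sect_top ha hy0
    rw [hroot, mul_zero] at e
    have a0 := ha N (by omega)
    have a1 := ha (N + 1) (by omega)
    have a2 := ha (N + 2) (by omega)
    have e4 : altSum (downRatio (ratio a) (N + 1)) (a N / a (N + 1) / y) (N + 7) =
        a (N + 2) / a (N + 1) * y := by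
      rcases mul_eq_zero.1 e.symm with e5 | e5
      · exact absurd e5 (by positivity)
      · linarith
    rw [e4, ratio]
    field_simp

lemma downRatio_mem {s : ℕ → ℝ} {n : ℕ} {P : ℝ → Prop} (h0 : P (s 0))
    (h : ∀ m, 1 ≤ m → m < n → P (s m)) (i : ℕ) : P (downRatio s n i) := by
  rw [downRatio]
  rcases Nat.eq_zero_or_pos (n - 1 - i) with h1 | h1
  · rwa [h1]
  · exact h _ h1 (by omega)

/-- A two-sided alternating expansion with nearly balanced neighbours is positive. -/
lemma interior_pos {σ τ : ℕ → ℝ} (hσ0 : ∀ i, 0 ≤ σ i) (hσ1 : ∀ i, σ i ≤ 1 / 3)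
    (hτ0 : ∀ i, 0 ≤ τ i) (hτ1 : ∀ i, τ i ≤ 1 / 3) {z : ℝ} (hz : 0 < z) (hzz : z * z ≤ 31 / 100)
    (hτ : 1 / 5 ≤ τ 0) (hcase : z ≤ 1 / 2 ∨ 1 / 4 ≤ σ 0) {m m' : ℕ} :
    0 < altSum σ z (m + 4) + altSum τ z (m' + 4) - 1 := by
  have hz57 : z ≤ 557 / 1000 := by nlinarith
  have bd := (altSum_bounds hσ0 hσ1 hz.le (by linarith) m).1
  have bu := (altSum_bounds hτ0 hτ1 hz.le (by linarith) m').1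
  have key : ∀ u v l : ℝ, 0 ≤ l → l ≤ u → u ≤ 1 / 3 → 0 ≤ v → v ≤ 1 / 3 →
      93 / 100 * l * (z * z) ≤ u * z ^ 2 - u ^ 2 * v * z ^ 3 := by
    intro u v l hl hlu hu hv0 hv
    have e2 : u * v ≤ 1 / 9 := by nlinarith
    have e1 : u * v * z ≤ 7 / 100 := by nlinarith
    have e3 : 93 / 100 * l ≤ u * (1 - u * v * z) := by nlinarith
    have e4 := mul_le_mul_of_nonneg_right e3 (mul_nonneg hz.le hz.le)
    linarith
  have hU := key (τ 0) (τ 1) (1 / 5) (by norm_num) hτ (hτ1 0) (hτ0 1) (hτ1 1)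
  have hzpos := mul_pos hz hz
  rcases hcase with h | h
  · have hD := key (σ 0) (σ 1) 0 le_rfl (hσ0 0) (hσ1 0) (hσ0 1) (hσ1 1)
    linarith
  · have hD := key (σ 0) (σ 1) (1 / 4) (by norm_num) h (hσ1 0) (hσ0 1) (hσ1 1)
    nlinarith

/-- Sampling criterion for a section to be hyperbolic. -/
lemma hyperbolic_sect_of_lt {a : ℕ → ℝ} {N : ℕ} (ha : ∀ j ≤ N + 2, 0 < a j)
    (hr : ∀ m, 1 ≤ m → m ≤ N → 1 / 4 ≤ ratio a m ∧ ratio a m ≤ 31 / 100)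
    (hr1 : 1 ≤ N → ratio a 1 ≤ 1 / 4) {x : ℝ} (hx : 1 / 2 ≤ x) (hx' : x ≤ 19 / 20)
    (hn : 1 / 5 ≤ ratio a (N + 1))
    (hlt : ratio a (N + 1) < x * altSum (downRatio (ratio a) (N + 1)) x (N + 7)) :
    Hyperbolic (sect a (N + 2)) := by
  have hr0 : ratio a 0 = 0 := rfl
  have hdown0 : ∀ i, 0 ≤ downRatio (ratio a) (N + 1) i :=
    downRatio_mem (P := fun t => 0 ≤ t) hr0.ge fun m h1 h2 =>
      le_trans (by norm_num) (hr m h1 (by omega)).1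
  have hdown1 : ∀ i, downRatio (ratio a) (N + 1) i ≤ 31 / 100 :=
    downRatio_mem (P := fun t => t ≤ 31 / 100) (by rw [hr0]; norm_num) fun m h1 h2 =>
      (hr m h1 (by omega)).2
  have hn' : ratio a (N + 1) ≤ 1 / 3 := by
    have hub := (altSum_bounds hdown0 (fun i => (hdown1 i).trans (by norm_num))
      (show 0 ≤ x by linarith) (by linarith) (N + 3)).2
    set d0 := downRatio (ratio a) (N + 1) 0
    set d1 := downRatio (ratio a) (N + 1) 1
    set d2 := downRatio (ratio a) (N + 1) 2
    have p0 : 0 ≤ d0 := hdown0 0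
    have p1 : 0 ≤ d1 := hdown0 1
    have p2 : 0 ≤ d2 := hdown0 2
    have q0 : d0 ≤ 31 / 100 := hdown1 0
    have q1 : d1 ≤ 31 / 100 := hdown1 1
    have q2 : d2 ≤ 31 / 100 := hdown1 2
    have hprod : d0 * d1 * d2 * x ≤ 1 := by
      have e1 : d0 * d1 ≤ 1 := by nlinarith
      have e2 : d0 * d1 * d2 ≤ 1 := by nlinarith [mul_nonneg p0 p1]
      nlinarith [mul_nonneg (mul_nonneg p0 p1) p2]
    have hneg : d0 ^ 3 * d1 ^ 2 * d2 * x ^ 4 ≤ d0 ^ 2 * d1 * x ^ 3 := by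
      have e3 : 0 ≤ d0 ^ 2 * d1 * x ^ 3 := by
        have : 0 ≤ x := by linarith
        positivity
      calc d0 ^ 3 * d1 ^ 2 * d2 * x ^ 4 = d0 ^ 2 * d1 * x ^ 3 * (d0 * d1 * d2 * x) := by ring
        _ ≤ _ := mul_le_of_le_one_right e3 hprod
    have hle : altSum (downRatio (ratio a) (N + 1)) x (N + 7) ≤ 1 - x + 31 / 100 * x ^ 2 := by
      nlinarith
    have : x * (1 - x + 31 / 100 * x ^ 2) ≤ 1 / 3 := by
      nlinarith [mul_nonneg (sub_nonneg.2 hx) (sq_nonneg (x - 4 / 5)),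
        mul_nonneg (sub_nonneg.2 hx') (sq_nonneg (x - 4 / 5)), sq_nonneg (x - 4 / 5)]
    nlinarith
  have hpos : ∀ m, 1 ≤ m → m ≤ N + 1 → 0 < ratio a m := by
    intro m h1 h2
    obtain ⟨j, rfl⟩ : ∃ j, m = j + 1 := ⟨m - 1, by omega⟩
    exact ratio_pos fun i hi => ha i (by omega)
  have hthird : ∀ m, m ≤ N + 1 → ratio a m ≤ 1 / 3 := by
    intro m h2
    rcases Nat.eq_zero_or_pos m with rfl | h1
    · rw [hr0]
      norm_num
    · rcases h2.lt_or_eq with h2 | rfl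
      · exact (hr m h1 (by omega)).2.trans (by norm_num)
      · exact hn'
  have hnonneg : ∀ m, m ≤ N + 1 → 0 ≤ ratio a m := by
    intro m h2
    rcases Nat.eq_zero_or_pos m with rfl | h1
    · exact hr0.ge
    · exact (hpos m h1 h2).le
  -- the sampling points, `q k` being the common size of the two neighbouring quotients
  set q : ℕ → ℝ := fun k => √(ratio a k) with hq
  set η : ℕ → ℝ := fun k => if k = 0 then 0 else if k ≤ N then a (k - 1) / a k / q k
    else a N / a (N + 1) / x with hη
  have hq0 : ∀ k, 1 ≤ k → k ≤ N + 1 → 0 < q k := fun k h1 h2 => Real.sqrt_pos.2 (hpos k h1 h2)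
  have hqsq : ∀ k, k ≤ N + 1 → q k * q k = ratio a k := fun k h2 =>
    Real.mul_self_sqrt (hnonneg k h2)
  have hq1 : ∀ k, k ≤ N + 1 → q k < 1 := fun k h2 => by
    nlinarith [hqsq k h2, hthird k h2, Real.sqrt_nonneg (ratio a k)]
  have hηtop : η (N + 1) = a N / a (N + 1) / x := by simp [hη]
  have hηmid : ∀ k, k + 1 ≤ N → η (k + 1) = a k / a (k + 1) / q (k + 1) := by
    intro k hk
    simp [hη, hk]
  have hηup : ∀ k, k + 1 ≤ N → η (k + 1) = a (k + 1) / a (k + 2) * q (k + 1) := by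
    intro k hk
    have a0 := ha k (by omega)
    have a1 := ha (k + 1) (by omega)
    have a2 := ha (k + 2) (by omega)
    have hqk := hq0 (k + 1) (by omega) (by omega)
    have h2 := hqsq (k + 1) (by omega)
    rw [ratio] at h2
    rw [hηmid k hk, div_eq_iff hqk.ne', mul_assoc, h2]
    field_simp
  have hηpos : ∀ k, 1 ≤ k → k ≤ N + 1 → 0 < η k := by
    intro k h1 h2
    obtain ⟨j, rfl⟩ : ∃ j, k = j + 1 := ⟨k - 1, by omega⟩
    have a0 := ha j (by omega)
    have a1 := ha (j + 1) (by omega)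
    rcases h2.lt_or_eq with h2 | h2
    · rw [hηmid j (by omega)]
      have := hq0 (j + 1) (by omega) (by omega)
      positivity
    · obtain rfl : j = N := by omega
      rw [hηtop]
      have : 0 < x := by linarith
      positivity
  refine hyperbolic_of_alternating (n := N + 1) (natDegree_sect_le a (N + 2)) (fun k => -η k) ?_ ?_
  · intro k hk
    refine neg_lt_neg ?_
    rcases Nat.eq_zero_or_pos k with rfl | h1
    · have : η 0 = 0 := by simp [hη]
      rw [this]
      exact hηpos _ (by omega) (by omega)
    · obtain ⟨j, rfl⟩ : ∃ j, k = j + 1 := ⟨k - 1, by omega⟩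
      have a1 := ha (j + 1) (by omega)
      have a2 := ha (j + 2) (by omega)
      have hρ : 0 < a (j + 1) / a (j + 2) := by positivity
      have hlow : η (j + 1) < a (j + 1) / a (j + 2) := by
        rw [hηup j (by omega)]
        exact mul_lt_of_lt_one_right hρ (hq1 _ (by omega))
      refine hlow.trans_le ?_
      rcases (show j + 2 ≤ N ∨ j + 2 = N + 1 by omega) with h2 | h2
      · rw [hηmid (j + 1) h2, le_div_iff₀ (hq0 _ (by omega) (by omega))]
        exact mul_le_of_le_one_right hρ.le (hq1 _ (by omega)).le
      · obtain rfl : N = j + 1 := by omega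
        rw [hηtop, le_div_iff₀ (by linarith)]
        exact mul_le_of_le_one_right hρ.le (by linarith)
  · intro k hk
    rcases Nat.eq_zero_or_pos k with rfl | h1
    · have : η 0 = 0 := by simp [hη]
      simp only [this, pow_zero, one_mul, neg_zero]
      rw [← coeff_zero_eq_eval_zero, coeff_sect, if_pos (Nat.zero_le _)]
      exact ha 0 (Nat.zero_le _)
    · obtain ⟨j, rfl⟩ : ∃ j, k = j + 1 := ⟨k - 1, by omega⟩
      have a0 := ha j (by omega)
      have a1 := ha (j + 1) (by omega)
      have a2 := ha (j + 2) (by omega)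
      have hy := hηpos (j + 1) h1 hk
      rcases (show j + 1 ≤ N ∨ j = N by omega) with h2 | rfl
      · obtain ⟨d, rfl⟩ : ∃ d, N = j + 1 + d := ⟨N - (j + 1), by omega⟩
        rw [show j + 1 + d + 2 = j + 1 + (d + 1) + 1 by ring]
        have hev := eval_sect_two_sided (N := j) (d := d + 1)
          (fun i hi => ha i (by omega)) hy 4 4
        have hxd : a j / a (j + 1) / η (j + 1) = q (j + 1) := by
          rw [hηmid j h2]
          have := hq0 (j + 1) (by omega) (by omega)
          field_simp
        have hxu : a (j + 2) / a (j + 1) * η (j + 1) = q (j + 1) := by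
          rw [hηup j h2]
          field_simp
        rw [hxd, hxu] at hev
        change 0 < (-1) ^ (j + 1) * eval (-η (j + 1)) (sect a (j + 1 + (d + 1) + 1))
        rw [hev]
        refine mul_pos (by positivity) ?_
        have hqpos := hq0 (j + 1) (by omega) (by omega)
        have hqq := hqsq (j + 1) (by omega)
        refine interior_pos (σ := downRatio (ratio a) (j + 1)) (m := j + 2) (m' := d + 3)
          (downRatio_mem (P := fun t => 0 ≤ t) hr0.ge fun m h1 h2 => hnonneg m (by omega))
          (downRatio_mem (P := fun t => t ≤ 1 / 3) (hthird 0 (by omega)) fun m h1 h2 =>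
            hthird m (by omega)) (fun i => ?_) (fun i => ?_) hqpos
          (hqq.le.trans (hr (j + 1) (by omega) (by omega)).2) ?_ ?_
        · rw [upRatio]
          split_ifs with h3
          · exact hnonneg _ (by omega)
          · exact le_rfl
        · rw [upRatio]
          split_ifs with h3
          · exact hthird _ (by omega)
          · norm_num
        · rw [upRatio, if_pos (by omega)]
          rcases (show j + 2 ≤ j + 1 + d ∨ j + 2 = j + 1 + d + 1 by omega) with h3 | h3
          · exact le_trans (by norm_num) (hr (j + 2) (by omega) h3).1
          · change 1 / 5 ≤ ratio a (j + 2)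
            rw [h3]
            exact hn
        · rcases Nat.eq_zero_or_pos j with rfl | hj
          · left
            have h14 := hr1 (by omega)
            rw [zero_add] at hqq hqpos
            nlinarith
          · right
            have hd0 : downRatio (ratio a) (j + 1) 0 = ratio a j := by simp [downRatio]
            rw [hd0]
            exact (hr j hj (by omega)).1
      · have hev := eval_sect_top ha hy
        have hx0 : 0 < x := by linarith
        have hxd : a j / a (j + 1) / η (j + 1) = x := by
          rw [hηtop]
          field_simp
        have hxu : a (j + 2) / a (j + 1) * η (j + 1) = ratio a (j + 1) / x := by
          rw [hηtop, ratio]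
          field_simp
        rw [hxd, hxu] at hev
        change 0 < (-1) ^ (j + 1) * eval (-η (j + 1)) (sect a (j + 2))
        rw [hev]
        refine mul_pos (by positivity) ?_
        rw [sub_pos, div_lt_iff₀ hx0, mul_comm]
        exact hlt

/-! ### The extremal coefficients -/

lemma Acoef_add_two (n : ℕ) : Acoef (n + 2) =
    sSup {t : ℝ | 0 < t ∧ Hyperbolic (sect Acoef (n + 1) + C t * X ^ (n + 1 + 1))} := by
  rw [Acoef]
  congr 1
  ext t
  rw [Set.mem_ofPred_eq, Set.mem_ofPred_eq, sect,
    Finset.sum_attach (Finset.range (n + 2)) fun j => C (Acoef j) * X ^ j]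

lemma ratio_congr {a b : ℕ → ℝ} {n : ℕ} (h : ∀ j ≤ n + 1, a j = b j) (m : ℕ) (hm : m ≤ n) :
    ratio a m = ratio b m := by
  rcases m with _ | m
  · rfl
  · rw [ratio, ratio, h m (by omega), h (m + 1) (by omega), h (m + 2) (by omega)]

lemma downRatio_congr {s t : ℕ → ℝ} {n : ℕ} (h : ∀ m ≤ n, s m = t m) :
    downRatio s (n + 1) = downRatio t (n + 1) := by
  funext i
  exact h _ (by omega)

/-- One step of the construction of the extremal coefficients. -/
lemma Acoef_step {N : ℕ} (hA : ∀ j ≤ N + 1, 0 < Acoef j)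
    (hr : ∀ m, 1 ≤ m → m ≤ N → 1 / 4 ≤ ratio Acoef m ∧ ratio Acoef m ≤ 31 / 100)
    (hr1 : 1 ≤ N → ratio Acoef 1 ≤ 1 / 4)
    (hx : ∃ x, 1 / 2 ≤ x ∧ x ≤ 19 / 20 ∧
      1 / 5 < x * altSum (downRatio (ratio Acoef) (N + 1)) x (N + 7)) :
    0 < Acoef (N + 2) ∧ Hyperbolic (sect Acoef (N + 2)) ∧
      ∀ x, 1 / 2 ≤ x → x ≤ 19 / 20 →
        1 / 5 < x * altSum (downRatio (ratio Acoef) (N + 1)) x (N + 7) →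
        x * altSum (downRatio (ratio Acoef) (N + 1)) x (N + 7) ≤ ratio Acoef (N + 1) := by
  set S := {t : ℝ | 0 < t ∧ Hyperbolic (sect Acoef (N + 1) + C t * X ^ (N + 1 + 1))} with hS
  have hsup : Acoef (N + 2) = sSup S := Acoef_add_two N
  have a0 := hA N (by omega)
  have a1 := hA (N + 1) le_rfl
  have hK : 0 < Acoef (N + 1) ^ 2 / Acoef N := by positivity
  set b : ℝ → ℕ → ℝ := fun t => Function.update Acoef (N + 2) t with hb
  have hbA : ∀ t, ∀ j ≤ N + 1, b t j = Acoef j := fun t j hj =>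
    Function.update_of_ne (by omega) _ _
  have hbt : ∀ t, b t (N + 2) = t := fun t => Function.update_self _ _ _
  have hbpos : ∀ t, 0 < t → ∀ j ≤ N + 2, 0 < b t j := by
    intro t ht j hj
    rcases hj.lt_or_eq with h | rfl
    · rw [hbA t j (by omega)]
      exact hA j (by omega)
    · rwa [hbt]
  have hbr : ∀ t, ∀ m ≤ N, ratio (b t) m = ratio Acoef m := fun t m hm =>
    ratio_congr (hbA t) m hm
  have hbtop : ∀ t, ratio (b t) (N + 1) = t / (Acoef (N + 1) ^ 2 / Acoef N) := by
    intro t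
    rw [ratio, hbA t N (by omega), hbA t (N + 1) le_rfl, hbt]
    field_simp
  have hbsect : ∀ t, sect (b t) (N + 2) = sect Acoef (N + 1) + C t * X ^ (N + 1 + 1) := by
    intro t
    rw [sect_succ, hbt, sect_congr (hbA t)]
  have hmem : ∀ x, 1 / 2 ≤ x → x ≤ 19 / 20 → ∀ r, 1 / 5 ≤ r →
      r < x * altSum (downRatio (ratio Acoef) (N + 1)) x (N + 7) →
      r * (Acoef (N + 1) ^ 2 / Acoef N) ∈ S := by
    intro x h1 h2 r h3 h4
    have hpos : 0 < r * (Acoef (N + 1) ^ 2 / Acoef N) := mul_pos (by linarith) hK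
    refine ⟨hpos, ?_⟩
    have hrr : ratio (b (r * (Acoef (N + 1) ^ 2 / Acoef N))) (N + 1) = r := by
      rw [hbtop]
      field_simp
    rw [← hbsect]
    refine hyperbolic_sect_of_lt (hbpos _ hpos) (fun m hm1 hm2 => ?_) (fun h => ?_) h1 h2 ?_ ?_
    · rw [hbr _ m hm2]
      exact hr m hm1 hm2
    · rw [hbr _ 1 h]
      exact hr1 h
    · rwa [hrr]
    · rwa [hrr, downRatio_congr (hbr _)]
  have hne : S.Nonempty := by
    obtain ⟨x, h1, h2, h3⟩ := hx
    exact ⟨_, hmem x h1 h2 (1 / 5) le_rfl h3⟩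
  have hbdd : BddAbove S := by
    refine ⟨Acoef (N + 1) ^ 2 / Acoef N, ?_⟩
    rintro t ⟨ht, hhyp⟩
    rw [← hbsect] at hhyp
    have hle := (hhyp.ratio_bounds (hbpos t ht)).1
    have hN : ratio (b t) N ≤ 31 / 100 := by
      rw [hbr t N le_rfl]
      rcases Nat.eq_zero_or_pos N with h | h
      · rw [h]
        norm_num [ratio]
      · exact (hr N h le_rfl).2
    have hp := ratio_pos (hbpos t ht)
    have : ratio (b t) (N + 1) ≤ 1 := by nlinarith
    rw [hbtop, div_le_one hK] at this
    exact this
  obtain ⟨hpos, hhyp⟩ := hyperbolic_sSup (natDegree_sect_le Acoef (N + 1)) hne hbdd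
  rw [← hS, ← hsup] at hpos hhyp
  refine ⟨hpos, ?_, ?_⟩
  · rw [sect_succ]
    exact hhyp
  · intro x h1 h2 h3
    refine le_of_forall_lt_imp_le_of_dense fun r hrlt => ?_
    have hmax := hmem x h1 h2 (max r (1 / 5)) (le_max_right _ _) (max_lt hrlt h3)
    have hle := le_csSup hbdd hmax
    rw [← hsup] at hle
    have : ratio Acoef (N + 1) = Acoef (N + 2) / (Acoef (N + 1) ^ 2 / Acoef N) := by
      rw [ratio]
      field_simp
    rw [this]
    exact (le_max_left _ _).trans ((le_div_iff₀ hK).2 hle)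

/-- Numerical enclosure of the extremal ratios. -/
structure RatioBound (m : ℕ) (r : ℝ) : Prop where
  one : m = 1 → r = 1 / 4
  two : m = 2 → r = 8 / 27
  three : m = 3 → 306 / 1000 ≤ r ∧ r ≤ 3064 / 10000
  four : 4 ≤ m → 308 / 1000 ≤ r ∧ r ≤ 31 / 100

lemma RatioBound.bounds {m : ℕ} {r : ℝ} (h : RatioBound m r) (hm : 1 ≤ m) :
    1 / 4 ≤ r ∧ r ≤ 31 / 100 := by
  rcases (show m = 1 ∨ m = 2 ∨ m = 3 ∨ 4 ≤ m by omega) with h1 | h1 | h1 | h1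
  · rw [h.one h1]; norm_num
  · rw [h.two h1]; norm_num
  · have := h.three h1
    constructor <;> linarith
  · have := h.four h1
    constructor <;> linarith

lemma RatioBound.bounds_of_two_le {m : ℕ} {r : ℝ} (h : RatioBound m r) (hm : 2 ≤ m) :
    8 / 27 ≤ r := by
  rcases (show m = 2 ∨ m = 3 ∨ 4 ≤ m by omega) with h1 | h1 | h1
  · rw [h.two h1]
  · have := h.three h1
    linarith
  · have := h.four h1
    linarith

lemma RatioBound.bounds_of_three_le {m : ℕ} {r : ℝ} (h : RatioBound m r) (hm : 3 ≤ m) :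
    306 / 1000 ≤ r := by
  rcases (show m = 3 ∨ 4 ≤ m by omega) with h1 | h1
  · exact (h.three h1).1
  · have := h.four h1
    linarith

/-- The alternating sum on the interval used for the sampling point is large enough. -/
lemma one_fifth_lt_mul_altSum {σ : ℕ → ℝ} (h0 : ∀ i, 0 ≤ σ i) (h1 : ∀ i, σ i ≤ 31 / 100)
    (h : 1 / 4 ≤ σ 0) {x : ℝ} (hx : 1 / 2 ≤ x) (hx' : x ≤ 19 / 20) (m : ℕ) :
    1 / 5 < x * altSum σ x (m + 4) := by
  have hb := (altSum_bounds h0 (fun i => (h1 i).trans (by norm_num)) (by linarith)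
    (by linarith : x ≤ 1) m).1
  have e1 : σ 0 ^ 2 * σ 1 ≤ 3 / 100 := by
    have : σ 0 ^ 2 ≤ (31 / 100) ^ 2 := pow_le_pow_left₀ (h0 0) (h1 0) 2
    nlinarith [h0 1, h1 1]
  have e2 : 1 / 4 * x ^ 2 ≤ σ 0 * x ^ 2 := mul_le_mul_of_nonneg_right h (sq_nonneg x)
  have e3 : σ 0 ^ 2 * σ 1 * x ^ 3 ≤ 3 / 100 * x ^ 3 :=
    mul_le_mul_of_nonneg_right e1 (by positivity)
  have e4 : 1 - x + 1 / 4 * x ^ 2 - 3 / 100 * x ^ 3 ≤ altSum σ x (m + 4) := by linarith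
  have e5 := mul_le_mul_of_nonneg_left e4 (show 0 ≤ x by linarith)
  refine lt_of_lt_of_le ?_ e5
  nlinarith [mul_nonneg (sub_nonneg.2 hx) (sub_nonneg.2 hx'), sq_nonneg (x - 7 / 10),
    mul_nonneg (mul_nonneg (sub_nonneg.2 hx) (sub_nonneg.2 hx')) (show 0 ≤ x by linarith),
    mul_nonneg (mul_nonneg (sub_nonneg.2 hx) (sub_nonneg.2 hx')) (sq_nonneg x)]

/-- Numerical bound behind the uniform upper estimate for the extremal ratios. -/
lemma quintic_le {p q r x : ℝ} (hp0 : 306 / 1000 ≤ p) (hp : p ≤ 31 / 100) (hq0 : 8 / 27 ≤ q)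
    (hq : q ≤ 31 / 100) (hr0 : 0 ≤ r) (hr : r ≤ 31 / 100) (hx : 0 ≤ x) (hx' : x ≤ 15 / 16) :
    x * (1 - x + p * x ^ 2 - p ^ 2 * q * x ^ 3 + p ^ 3 * q ^ 2 * r * x ^ 4) ≤ 31 / 100 := by
  have h1 : p ^ 3 * q ^ 2 * r * x ≤ p ^ 2 * q * (31 / 100 * (31 / 100) * (31 / 100) * x) := by
    have e1 : p * q * r ≤ 31 / 100 * (31 / 100) * (31 / 100) :=
      mul_le_mul (mul_le_mul hp hq (by linarith) (by norm_num)) hr hr0 (by norm_num)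
    have e2 := mul_le_mul_of_nonneg_right e1 hx
    have e3 : 0 ≤ p ^ 2 * q := by positivity
    have e4 := mul_le_mul_of_nonneg_left e2 e3
    linarith
  have hk : 0 ≤ 1 - 31 / 100 * (31 / 100) * (31 / 100) * x := by linarith
  have h2 : p - p ^ 2 * q * x + p ^ 3 * q ^ 2 * r * x ^ 2 ≤
      p - p ^ 2 * (8 / 27) * x * (1 - 31 / 100 * (31 / 100) * (31 / 100) * x) := by
    have e1 := mul_le_mul_of_nonneg_left h1 hx
    have e2 : p ^ 2 * (8 / 27) * (x * (1 - 31 / 100 * (31 / 100) * (31 / 100) * x)) ≤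
        p ^ 2 * q * (x * (1 - 31 / 100 * (31 / 100) * (31 / 100) * x)) :=
      mul_le_mul_of_nonneg_right (mul_le_mul_of_nonneg_left hq0 (sq_nonneg p))
        (mul_nonneg hx hk)
    linarith
  have h3 : p - p ^ 2 * (8 / 27) * x * (1 - 31 / 100 * (31 / 100) * (31 / 100) * x) ≤
      31 / 100 - (31 / 100) ^ 2 * (8 / 27) * x * (1 - 31 / 100 * (31 / 100) * (31 / 100) * x) := by
    have e0 : 0 ≤ 8 / 27 * x * (1 - 31 / 100 * (31 / 100) * (31 / 100) * x) := by positivity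
    have e0' : 8 / 27 * x * (1 - 31 / 100 * (31 / 100) * (31 / 100) * x) ≤ 1 := by nlinarith
    nlinarith [mul_nonneg (sub_nonneg.2 hp) (sub_nonneg.2 e0')]
  have h4 := mul_le_mul_of_nonneg_left (h2.trans h3) (show 0 ≤ x ^ 3 by positivity)
  have h5 : x - x ^ 2 + x ^ 3 * (31 / 100 - (31 / 100) ^ 2 * (8 / 27) * x *
      (1 - 31 / 100 * (31 / 100) * (31 / 100) * x)) ≤ 31 / 100 := by
    have c := sq_nonneg (x - 7209 / 10000)
    have d := sub_nonneg.2 hx'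
    linarith [c, mul_nonneg d c, mul_nonneg (sq_nonneg x) c,
      mul_nonneg (mul_nonneg (sq_nonneg x) d) c]
  linarith

/-- Numerical bound behind the uniform lower estimate for the extremal ratios. -/
lemma le_quartic {p q : ℝ} (hp0 : 306 / 1000 ≤ p) (hp : p ≤ 31 / 100) (hq : q ≤ 31 / 100) :
    308 / 1000 ≤ 717 / 1000 * (1 - 717 / 1000 + p * (717 / 1000) ^ 2 -
      p ^ 2 * q * (717 / 1000) ^ 3) := by
  have h1 : p ^ 2 * q ≤ p ^ 2 * (31 / 100) := mul_le_mul_of_nonneg_left hq (sq_nonneg p)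
  nlinarith [mul_nonneg (sub_nonneg.2 hp0) (sub_nonneg.2 hp)]

lemma ratioBound_succ {s : ℕ → ℝ} (hs : s 0 = 0) {N : ℕ} {r : ℝ} (hN : 1 ≤ N)
    (hr : ∀ m, 1 ≤ m → m ≤ N → RatioBound m (s m))
    (hup : ∃ x, 0 < x ∧ x ≤ 15 / 16 ∧ r = x * altSum (downRatio s (N + 1)) x (N + 7))
    (hlow : ∀ x, 1 / 2 ≤ x → x ≤ 19 / 20 → x * altSum (downRatio s (N + 1)) x (N + 7) ≤ r) :
    RatioBound (N + 1) r := by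
  have h0 : ∀ i, 0 ≤ downRatio s (N + 1) i :=
    downRatio_mem (P := fun t => 0 ≤ t) hs.ge fun m h1 h2 =>
      le_trans (by norm_num) ((hr m h1 (by omega)).bounds h1).1
  have h1 : ∀ i, downRatio s (N + 1) i ≤ 31 / 100 :=
    downRatio_mem (P := fun t => t ≤ 31 / 100) (by rw [hs]; norm_num) fun m h1 h2 =>
      ((hr m h1 (by omega)).bounds h1).2
  have h3 : ∀ i, downRatio s (N + 1) i ≤ 1 / 3 := fun i => (h1 i).trans (by norm_num)
  obtain ⟨x, hx0, hx1, hxr⟩ := hup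
  have hub := (altSum_bounds h0 h3 hx0.le (by linarith) (N + 3)).2
  have hub' := mul_le_mul_of_nonneg_left hub hx0.le
  rw [← hxr] at hub'
  have hlb : ∀ z, 1 / 2 ≤ z → z ≤ 19 / 20 → z * (1 - z + downRatio s (N + 1) 0 * z ^ 2 -
      downRatio s (N + 1) 0 ^ 2 * downRatio s (N + 1) 1 * z ^ 3) ≤ r := by
    intro z h4 h5
    refine le_trans ?_ (hlow z h4 h5)
    exact mul_le_mul_of_nonneg_left
      (altSum_bounds h0 h3 (by linarith) (by linarith) (N + 3)).1 (by linarith)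
  have d0 : downRatio s (N + 1) 0 = s N := by simp [downRatio]
  have d1 : downRatio s (N + 1) 1 = s (N - 1) := by simp [downRatio]
  have d2 : downRatio s (N + 1) 2 = s (N - 2) := by simp [downRatio]
  rw [d0, d1] at hlb
  rw [d0, d1, d2] at hub'
  rcases (show N = 1 ∨ N = 2 ∨ 3 ≤ N by omega) with rfl | rfl | h
  · have e1 := (hr 1 le_rfl le_rfl).one rfl
    simp only [Nat.sub_self, hs, e1] at hub' hlb
    have hl := hlb (2 / 3) (by norm_num) (by norm_num)
    have : r = 8 / 27 := by
      refine le_antisymm (hub'.trans ?_) (le_trans (by norm_num) hl)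
      nlinarith [mul_nonneg (sq_nonneg (x - 2 / 3)) (show 0 ≤ 2 / 3 - x / 4 by linarith)]
    exact ⟨by omega, fun _ => this, by omega, by omega⟩
  · have e1 := (hr 1 le_rfl (by omega)).one rfl
    have e2 := (hr 2 (by omega) le_rfl).two rfl
    simp only [Nat.sub_self, hs, show 2 - 1 = 1 from rfl, e1, e2] at hub' hlb
    have hl := hlb (706 / 1000) (by norm_num) (by norm_num)
    refine ⟨by omega, by omega, fun _ => ⟨le_trans (by norm_num) hl, hub'.trans ?_⟩, by omega⟩
    nlinarith [mul_nonneg hx0.le (sq_nonneg (x - 706 / 1000)), sq_nonneg (x - 706 / 1000),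
      mul_nonneg (sub_nonneg.2 hx1) (sq_nonneg (x - 706 / 1000)),
      mul_nonneg (mul_nonneg hx0.le hx0.le) (sq_nonneg (x - 706 / 1000)),
      mul_nonneg (mul_nonneg hx0.le (sub_nonneg.2 hx1)) (sq_nonneg (x - 706 / 1000))]
  · have b0 := (hr N (by omega) le_rfl).bounds_of_three_le h
    have b1 := (hr N (by omega) le_rfl).bounds (by omega)
    have b2 := (hr (N - 1) (by omega) (by omega)).bounds_of_two_le (by omega)
    have b3 := (hr (N - 1) (by omega) (by omega)).bounds (by omega)
    have b4 := (hr (N - 2) (by omega) (by omega)).bounds (by omega)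
    refine ⟨by omega, by omega, by omega, fun _ => ⟨?_, ?_⟩⟩
    · exact (le_quartic b0 b1.2 b3.2).trans (hlb (717 / 1000) (by norm_num) (by norm_num))
    · exact hub'.trans (quintic_le b0 b1.2 b2 b3.2 (by linarith) b4.2 hx0.le hx1)

lemma ratio_Acoef_one_le {N : ℕ} (h : ∀ m, 1 ≤ m → m ≤ N → RatioBound m (ratio Acoef m))
    (hN : 1 ≤ N) : ratio Acoef 1 ≤ 1 / 4 :=
  ((h 1 le_rfl hN).one rfl).le

lemma Acoef_sampling {N : ℕ} (hr : ∀ m, 1 ≤ m → m ≤ N → RatioBound m (ratio Acoef m))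
    (hN : 1 ≤ N) {x : ℝ} (hx : 1 / 2 ≤ x) (hx' : x ≤ 19 / 20) :
    1 / 5 < x * altSum (downRatio (ratio Acoef) (N + 1)) x (N + 7) := by
  refine one_fifth_lt_mul_altSum (m := N + 3) ?_ ?_ ?_ hx hx'
  · exact downRatio_mem (P := fun t => 0 ≤ t) le_rfl fun m h1 h2 =>
      le_trans (by norm_num) ((hr m h1 (by omega)).bounds h1).1
  · exact downRatio_mem (P := fun t => t ≤ 31 / 100) (by norm_num [ratio]) fun m h1 h2 =>
      ((hr m h1 (by omega)).bounds h1).2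
  · exact ((hr N hN le_rfl).bounds hN).1

lemma Acoef_sampling_zero : (1 / 2 : ℝ) * (1 / 2) ≤
    1 / 2 * altSum (downRatio (ratio Acoef) (0 + 1)) (1 / 2) (0 + 7) := by
  have h0 : ∀ i, downRatio (ratio Acoef) (0 + 1) i = 0 := fun i => by simp [downRatio, ratio]
  have := (altSum_bounds (fun i => (h0 i).ge) (fun i => (h0 i).le.trans (by norm_num))
    (show (0 : ℝ) ≤ 1 / 2 by norm_num) (by norm_num) 3).1
  rw [h0] at this
  norm_num at this ⊢
  linarith

/-- The extremal coefficients are positive, all their sections are hyperbolic, and their ratios are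
enclosed numerically. -/
lemma Acoef_properties (N : ℕ) : (∀ j ≤ N + 1, 0 < Acoef j) ∧
    (∀ j, 1 ≤ j → j ≤ N + 1 → Hyperbolic (sect Acoef j)) ∧
    ∀ m, 1 ≤ m → m ≤ N → RatioBound m (ratio Acoef m) := by
  induction N with
  | zero =>
    have A0 : Acoef 0 = 1 := by rw [Acoef]
    have A1 : Acoef 1 = 1 := by rw [Acoef]
    refine ⟨fun j hj => ?_, fun j h1 h2 => ?_, fun m h1 h2 => by omega⟩
    · rcases (show j = 0 ∨ j = 1 by omega) with rfl | rfl
      · rw [A0]; exact one_pos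
      · rw [A1]; exact one_pos
    · obtain rfl : j = 1 := by omega
      refine hyperbolic_of_alternating (n := 0) (natDegree_sect_le _ _) (fun _ => 0) (by simp) ?_
      intro k hk
      obtain rfl : k = 0 := by omega
      simp [eval_sect, Finset.sum_range_succ, A0]
  | succ N ih =>
    obtain ⟨hpos, hhyp, hr⟩ := ih
    have hx : ∃ x, 1 / 2 ≤ x ∧ x ≤ 19 / 20 ∧
        1 / 5 < x * altSum (downRatio (ratio Acoef) (N + 1)) x (N + 7) := by
      refine ⟨1 / 2, le_rfl, by norm_num, ?_⟩
      rcases Nat.eq_zero_or_pos N with rfl | h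
      · exact lt_of_lt_of_le (by norm_num) Acoef_sampling_zero
      · exact Acoef_sampling hr h le_rfl (by norm_num)
    obtain ⟨p1, p2, p3⟩ := Acoef_step hpos (fun m h1 h2 => (hr m h1 h2).bounds h1)
      (ratio_Acoef_one_le hr) hx
    have hpos' : ∀ j ≤ N + 2, 0 < Acoef j := by
      intro j hj
      rcases hj.lt_or_eq with h | rfl
      · exact hpos j (by omega)
      · exact p1
    refine ⟨hpos', fun j h1 h2 => ?_, fun m h1 h2 => ?_⟩
    · rcases h2.lt_or_eq with h | rfl
      · exact hhyp j h1 (by omega)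
      · exact p2
    · rcases h2.lt_or_eq with h | rfl
      · exact hr m h1 (by omega)
      · rcases Nat.eq_zero_or_pos N with rfl | hN
        · have hle := (p2.ratio_bounds hpos').1
          have h0 : ratio Acoef 0 = 0 := rfl
          rw [h0] at hle
          have hge := p3 (1 / 2) le_rfl (by norm_num)
            (lt_of_lt_of_le (by norm_num) Acoef_sampling_zero)
          have hge' := Acoef_sampling_zero.trans hge
          exact ⟨fun _ => by norm_num at *; linarith, by omega, by omega, by omega⟩
        · exact ratioBound_succ rfl hN hr
            (p2.exists_root hpos' ((hr N hN le_rfl).bounds hN).2).2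
            fun x h3 h4 => p3 x h3 h4 (Acoef_sampling hr hN h3 h4)

lemma ratioBound_Acoef {m : ℕ} (hm : 1 ≤ m) : RatioBound m (ratio Acoef m) :=
  (Acoef_properties m).2.2 m hm le_rfl

lemma Acoef_pos (j : ℕ) : 0 < Acoef j := (Acoef_properties j).1 j (by omega)

lemma mul_altSum_le_ratio_Acoef {N : ℕ} (hN : 1 ≤ N) {x : ℝ} (hx : 1 / 2 ≤ x)
    (hx' : x ≤ 19 / 20) :
    x * altSum (downRatio (ratio Acoef) (N + 1)) x (N + 7) ≤ ratio Acoef (N + 1) := by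
  have hr : ∀ m, 1 ≤ m → m ≤ N → RatioBound m (ratio Acoef m) := fun m h _ => ratioBound_Acoef h
  have hs := Acoef_sampling hr hN hx hx'
  exact (Acoef_step (fun j _ => Acoef_pos j) (fun m h1 h2 => (hr m h1 h2).bounds h1)
    (ratio_Acoef_one_le hr) ⟨x, hx, hx', hs⟩).2.2 x hx hx' hs

lemma bernstein_term_nonneg {E φ : ℝ} (hE : 0 ≤ E) (hE' : E ≤ 1 / 20) (hφ : 0 ≤ φ)
    (hφ' : φ ≤ 16 / 25) (i j k l : ℕ) :
    0 ≤ E ^ i * (1 / 20 - E) ^ j * (φ ^ k * (16 / 25 - φ) ^ l) := by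
  have := sub_nonneg.2 hE'
  have := sub_nonneg.2 hφ'
  positivity

/-- Monotonicity in the leading ratio of the quantity controlling the monotonicity of
`mul_altSum_le`. -/
lemma derivative_bound_mono {b L α E x : ℝ} (hE : E ≤ 1 / 20) (hL : 1 / 4 ≤ L)
    (hα : α + E ≤ 31 / 100) (hLα : L - E ≤ α) (hE0 : 0 ≤ E)
    (hb : b ≤ 31 / 100) (hb0 : 0 ≤ b) (hx : 1 / 2 ≤ x) (hx' : x ≤ 1) :
    3 * (L - E) * x ^ 2 - 4 * ((L - E) ^ 2 * b) * x ^ 3 ≤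
      3 * α * x ^ 2 - 4 * (α ^ 2 * b) * x ^ 3 := by
  have h1 : (α + (L - E)) * b ≤ 62 / 100 * (31 / 100) :=
    mul_le_mul (by linarith) hb hb0 (by norm_num)
  have h2 : 0 ≤ 3 - 4 * ((α + (L - E)) * b) * x := by nlinarith
  nlinarith [mul_nonneg (mul_nonneg (sub_nonneg.2 hLα) h2) (sq_nonneg x)]

lemma derivative_bound_three {E φ : ℝ} (hE : 0 ≤ E) (hE' : E ≤ 1 / 20) (hφ : 0 ≤ φ)
    (hφ' : φ ≤ 16 / 25) {x : ℝ} (hx : x = 706 / 1000 - 3 / 2 * E + 8 / 5 * φ * E) :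
    0 ≤ 1 - 2 * x + 3 * (8 / 27 - E) * x ^ 2 - 4 * ((8 / 27 - E) ^ 2 * (1 / 4)) * x ^ 3 +
      4 * (φ * E) * x ^ 3 := by
  have h := bernstein_term_nonneg hE hE' hφ hφ'
  rw [hx]
  linarith [
      h 0 5 0 4, h 0 5 1 3, h 0 5 2 2, h 0 5 3 1, h 0 5 4 0, h 1 4 0 4, h 1 4 1 3, h 1 4 2 2,
      h 1 4 3 1, h 1 4 4 0, h 2 3 0 4, h 2 3 1 3, h 2 3 2 2, h 2 3 3 1, h 2 3 4 0, h 3 2 0 4,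
      h 3 2 1 3, h 3 2 2 2, h 3 2 3 1, h 3 2 4 0, h 4 1 0 4, h 4 1 1 3, h 4 1 2 2, h 4 1 3 1,
      h 4 1 4 0, h 5 0 0 4, h 5 0 1 3, h 5 0 2 2, h 5 0 3 1, h 5 0 4 0]

lemma derivative_bound_four {E φ : ℝ} (hE : 0 ≤ E) (hE' : E ≤ 1 / 20) (hφ : 0 ≤ φ)
    (hφ' : φ ≤ 16 / 25) {x : ℝ} (hx : x = 711 / 1000 - 3 / 2 * E + 17 / 10 * φ * E) :
    0 ≤ 1 - 2 * x + 3 * (306 / 1000 - E) * x ^ 2 -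
      4 * ((306 / 1000 - E) ^ 2 * (31 / 100)) * x ^ 3 + 4 * (φ * E) * x ^ 3 := by
  have h := bernstein_term_nonneg hE hE' hφ hφ'
  rw [hx]
  linarith [
      h 0 5 0 4, h 0 5 1 3, h 0 5 2 2, h 0 5 3 1, h 0 5 4 0, h 1 4 0 4, h 1 4 1 3, h 1 4 2 2,
      h 1 4 3 1, h 1 4 4 0, h 2 3 0 4, h 2 3 1 3, h 2 3 2 2, h 2 3 3 1, h 2 3 4 0, h 3 2 0 4,
      h 3 2 1 3, h 3 2 2 2, h 3 2 3 1, h 3 2 4 0, h 4 1 0 4, h 4 1 1 3, h 4 1 2 2, h 4 1 3 1,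
      h 4 1 4 0, h 5 0 0 4, h 5 0 1 3, h 5 0 2 2, h 5 0 3 1, h 5 0 4 0]

lemma gap_bound_three {E φ : ℝ} (hE : 0 ≤ E) (hE' : E ≤ 1 / 20) (hφ : 0 ≤ φ)
    (hφ' : φ ≤ 16 / 25) {x : ℝ} (hx : x = 706 / 1000 - 3 / 2 * E + 8 / 5 * φ * E) :
    1502 / 10000 - 133 / 1000 * E ≤
      49 / 100 * (3 * x - 7 / 5) * (1 - ((16 / 27 - E) * (1 / 4) + φ) * x) := by
  have h := bernstein_term_nonneg hE hE' hφ hφ'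
  rw [hx]
  linarith [
      h 0 3 0 3, h 0 3 1 2, h 0 3 2 1, h 0 3 3 0, h 1 2 0 3, h 1 2 1 2, h 1 2 2 1, h 1 2 3 0,
      h 2 1 0 3, h 2 1 1 2, h 2 1 2 1, h 2 1 3 0, h 3 0 0 3, h 3 0 1 2, h 3 0 2 1, h 3 0 3 0]

lemma gap_bound_four {E φ : ℝ} (hE : 0 ≤ E) (hE' : E ≤ 1 / 20) (hφ : 0 ≤ φ)
    (hφ' : φ ≤ 16 / 25) {x : ℝ} (hx : x = 711 / 1000 - 3 / 2 * E + 17 / 10 * φ * E) :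
    1502 / 10000 - 133 / 1000 * E ≤
      49 / 100 * (3 * x - 7 / 5) * (1 - ((62 / 100 - E) * (31 / 100) + φ) * x +
        (17 / 10000 + 215 / 10000 * φ - 38 / 100 * E * φ)) := by
  have h := bernstein_term_nonneg hE hE' hφ hφ'
  rw [hx]
  linarith [
      h 0 3 0 3, h 0 3 1 2, h 0 3 2 1, h 0 3 3 0, h 1 2 0 3, h 1 2 1 2, h 1 2 2 1, h 1 2 3 0,
      h 2 1 0 3, h 2 1 1 2, h 2 1 2 1, h 2 1 3 0, h 3 0 0 3, h 3 0 1 2, h 3 0 2 1, h 3 0 3 0]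

lemma quadratic_term_four {E φ : ℝ} (hE : 0 ≤ E) (hE' : E ≤ 1 / 20) (hφ : 0 ≤ φ)
    (hφ' : φ ≤ 16 / 25) {x : ℝ} (hx : x = 711 / 1000 - 3 / 2 * E + 17 / 10 * φ * E) :
    17 / 10000 + 215 / 10000 * φ - 38 / 100 * E * φ ≤
      23 / 100 * (((306 / 1000) ^ 2 + 306 / 1000 * (306 / 1000 - E) + (306 / 1000 - E) ^ 2) *
        (8 / 27) ^ 2 + 2 * (306 / 1000 - E) * (8 / 27) * φ - φ ^ 2 * E * (1000 / 256)) *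
        x ^ 2 := by
  have h := bernstein_term_nonneg hE hE' hφ hφ'
  rw [hx]
  linarith [
      h 0 4 0 4, h 0 4 1 3, h 0 4 2 2, h 0 4 3 1, h 0 4 4 0, h 1 3 0 4, h 1 3 1 3, h 1 3 2 2,
      h 1 3 3 1, h 1 3 4 0, h 2 2 0 4, h 2 2 1 3, h 2 2 2 2, h 2 2 3 1, h 2 2 4 0, h 3 1 0 4,
      h 3 1 1 3, h 3 1 2 2, h 3 1 3 1, h 3 1 4 0, h 4 0 0 4, h 4 0 1 3, h 4 0 2 2, h 4 0 3 1,
      h 4 0 4 0]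

lemma cube_mul_mono {x y k c : ℝ} (hx : 3 / 5 ≤ x) (hx' : x ≤ 3 / 4) (hxy : x ≤ y)
    (hy : y ≤ 15 / 16) (hk : k ≤ 833 / 1000) (hc : 0 ≤ c) :
    x ^ 3 * (1 - k * x + c * x ^ 2) ≤ y ^ 3 * (1 - k * y + c * y ^ 2) := by
  have h5 : c * x ^ 5 ≤ c * y ^ 5 := by gcongr
  have h4 : k * (y ^ 4 - x ^ 4) ≤ 833 / 1000 * (y ^ 4 - x ^ 4) :=
    mul_le_mul_of_nonneg_right hk (sub_nonneg.2 (by gcongr))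
  have h : 0 ≤ y ^ 2 + x * y + x ^ 2 - 833 / 1000 * ((x + y) * (x ^ 2 + y ^ 2)) := by
    have h1 : 0 ≤ (25 / 16 * x - y) * (y - 16 / 25 * x) :=
      mul_nonneg (by linarith) (by linarith)
    have h2 : (x + y) * (x ^ 2 + y ^ 2) ≤ 27 / 16 * (x ^ 2 + y ^ 2) :=
      mul_le_mul_of_nonneg_right (by linarith) (by positivity)
    nlinarith
  have := mul_nonneg (sub_nonneg.2 hxy) h
  linarith

/-- Factorization of the leading part of `altSum_sub_ge`. -/
lemma gap_factor {b₁ b₂ b₃ α₁ α₂ E φ : ℝ} (hE : E = b₁ - α₁)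
    (hφ : α₁ ^ 2 * (b₂ - α₂) = φ * E) (y : ℝ) :
    y * (E * y ^ 2 - (b₁ ^ 2 * b₂ - α₁ ^ 2 * α₂) * y ^ 3 +
        23 / 25 * (b₃ * (b₁ ^ 3 * b₂ ^ 2 - α₁ ^ 3 * α₂ ^ 2)) * y ^ 4) =
      E * (y ^ 3 * (1 - ((2 * b₁ - E) * b₂ + φ) * y +
        23 / 25 * b₃ * ((b₁ ^ 2 + b₁ * α₁ + α₁ ^ 2) * b₂ ^ 2 + α₁ * (b₂ + α₂) * φ) *
          y ^ 2)) := by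
  subst hE
  linear_combination (-y ^ 4 + 23 / 25 * b₃ * α₁ * (b₂ + α₂) * y ^ 5) * hφ

lemma exists_mul_eq {ψ E : ℝ} (h0 : 0 ≤ ψ) (h : ψ ≤ 16 / 25 * E) :
    ∃ φ, 0 ≤ φ ∧ φ ≤ 16 / 25 ∧ ψ = φ * E := by
  rcases (show 0 ≤ E by linarith).eq_or_lt with hE | hE
  · exact ⟨0, le_rfl, by norm_num, by rw [← hE] at h; linarith⟩
  · exact ⟨ψ / E, by positivity, by rw [div_le_iff₀ hE]; exact h, by field_simp⟩

lemma tangent_le_cube {x : ℝ} (hx : 0 ≤ x) : 49 / 100 * (3 * x - 7 / 5) ≤ x ^ 3 := by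
  nlinarith [mul_nonneg (show 0 ≤ x + 7 / 5 by linarith) (sq_nonneg (x - 7 / 10))]

/-- Data of a sampling point at which the difference of two ratio sequences, given by their leading
terms, is well estimated from below. -/
def GapPoint (b₁ b₂ b₃ α₁ α₂ x : ℝ) : Prop :=
  1 / 2 ≤ x ∧ x ≤ 15 / 16 ∧ 0 ≤ 1 - 2 * x + 3 * α₁ * x ^ 2 - 4 * (α₁ ^ 2 * α₂) * x ^ 3 ∧
    ∀ y, x ≤ y → y ≤ 15 / 16 → (b₁ - α₁) * (1502 / 10000 - 133 / 1000 * (b₁ - α₁)) ≤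
      y * ((b₁ - α₁) * y ^ 2 - (b₁ ^ 2 * b₂ - α₁ ^ 2 * α₂) * y ^ 3 +
        23 / 25 * (b₃ * (b₁ ^ 3 * b₂ ^ 2 - α₁ ^ 3 * α₂ ^ 2)) * y ^ 4)

lemma gapPoint_two {α₁ : ℝ} (h : α₁ ≤ 1 / 4) (h' : 1 / 4 - α₁ ≤ 1 / 20) :
    GapPoint (1 / 4) 0 0 α₁ 0 (3 / 5) := by
  refine ⟨by norm_num, by norm_num, by linarith, fun y h1 h2 => ?_⟩
  have : (3 / 5) ^ 3 ≤ y ^ 3 := by gcongr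
  nlinarith [mul_nonneg (sub_nonneg.2 h) (sub_nonneg.2 this)]

/-- Assembling a sampling point from the numerical estimates at its left end. -/
lemma gapPoint_of_bounds {b₁ b₂ b₃ α₁ α₂ E φ x : ℝ} (hE : E = b₁ - α₁)
    (hφ : α₁ ^ 2 * (b₂ - α₂) = φ * E) (hE0 : 0 ≤ E) (hx : 3 / 5 ≤ x) (hx' : x ≤ 3 / 4)
    (hk : (2 * b₁ - E) * b₂ + φ ≤ 833 / 1000)
    (hc : 0 ≤ b₃ * ((b₁ ^ 2 + b₁ * α₁ + α₁ ^ 2) * b₂ ^ 2 + α₁ * (b₂ + α₂) * φ))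
    (hder : 0 ≤ 1 - 2 * x + 3 * α₁ * x ^ 2 - 4 * (α₁ ^ 2 * b₂) * x ^ 3 + 4 * (φ * E) * x ^ 3)
    (hgap : 1502 / 10000 - 133 / 1000 * E ≤ x ^ 3 * (1 - ((2 * b₁ - E) * b₂ + φ) * x +
      23 / 25 * b₃ * ((b₁ ^ 2 + b₁ * α₁ + α₁ ^ 2) * b₂ ^ 2 + α₁ * (b₂ + α₂) * φ) * x ^ 2)) :
    GapPoint b₁ b₂ b₃ α₁ α₂ x := by
  refine ⟨by linarith, by linarith, ?_, fun y h1 h2 => ?_⟩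
  · rw [← hφ] at hder
    linarith
  · rw [← hE, gap_factor hE hφ]
    exact mul_le_mul_of_nonneg_left
      (hgap.trans (cube_mul_mono hx hx' h1 h2 hk (by linarith))) hE0

lemma exists_gapPoint_three {α₁ α₂ : ℝ} (h : α₁ ≤ 8 / 27) (h' : 8 / 27 - α₁ ≤ 1 / 20)
    (h2 : α₂ ≤ 1 / 4) (hψ : α₁ ^ 2 * (1 / 4 - α₂) ≤ 16 / 25 * (8 / 27 - α₁)) :
    ∃ x, GapPoint (8 / 27) (1 / 4) 0 α₁ α₂ x := by
  obtain ⟨φ, hφ0, hφ1, hφ⟩ := exists_mul_eq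
    (mul_nonneg (sq_nonneg α₁) (sub_nonneg.2 h2)) hψ
  set E := 8 / 27 - α₁ with hE
  have hE0 : 0 ≤ E := sub_nonneg.2 h
  have hα : α₁ = 8 / 27 - E := by rw [hE]; ring
  obtain ⟨x, hx⟩ : ∃ x, x = 706 / 1000 - 3 / 2 * E + 8 / 5 * φ * E := ⟨_, rfl⟩
  have hφE := mul_nonneg hφ0 hE0
  have hφE' := mul_le_mul_of_nonneg_right hφ1 hE0
  have hd := derivative_bound_three hE0 h' hφ0 hφ1 hx
  have hg := gap_bound_three hE0 h' hφ0 hφ1 hx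
  have hxl : 3 / 5 ≤ x := by linarith
  have hxu : x ≤ 3 / 4 := by linarith
  have hS : 0 ≤ 1 - ((16 / 27 - E) * (1 / 4) + φ) * x := by
    have := mul_le_mul (show (16 / 27 - E) * (1 / 4) + φ ≤ 833 / 1000 by linarith) hxu
      (by linarith) (by norm_num)
    linarith
  refine ⟨x, gapPoint_of_bounds hE hφ hE0 hxl hxu (by linarith) (by simp) ?_
    (hg.trans ?_)⟩
  · rw [hα]
    exact hd
  · have := mul_le_mul_of_nonneg_right (tangent_le_cube (x := x) (by linarith)) hS
    linarith

/-- Lower bound for the coefficient of the quadratic term in `gap_factor`. -/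
lemma quadratic_coeff_ge {b₁ b₂ α₁ α₂ E φ : ℝ} (hb1 : 306 / 1000 ≤ b₁) (hb2 : 8 / 27 ≤ b₂)
    (h2 : α₂ ≤ b₂) (hE : E = b₁ - α₁) (hE' : E ≤ 1 / 20) (hφ0 : 0 ≤ φ)
    (hφ : α₁ ^ 2 * (b₂ - α₂) = φ * E) :
    ((306 / 1000) ^ 2 + 306 / 1000 * (306 / 1000 - E) + (306 / 1000 - E) ^ 2) *
        (8 / 27) ^ 2 + 2 * (306 / 1000 - E) * (8 / 27) * φ - φ ^ 2 * E * (1000 / 256) ≤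
      (b₁ ^ 2 + b₁ * α₁ + α₁ ^ 2) * b₂ ^ 2 + α₁ * (b₂ + α₂) * φ := by
  have hα0 : 256 / 1000 ≤ α₁ := by linarith only [hE, hb1, hE']
  have e0 : 306 / 1000 - E ≤ α₁ := by linarith only [hE, hb1]
  have e0' : 0 ≤ 306 / 1000 - E := by linarith only [hE']
  have e1 : ((306 / 1000) ^ 2 + 306 / 1000 * (306 / 1000 - E) + (306 / 1000 - E) ^ 2) *
      (8 / 27) ^ 2 ≤ (b₁ ^ 2 + b₁ * α₁ + α₁ ^ 2) * b₂ ^ 2 := by gcongr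
  have e2 : (306 / 1000 - E) * (8 / 27) ≤ α₁ * b₂ := by gcongr
  have e3 : 256 / 1000 * (α₁ * (b₂ - α₂)) ≤ α₁ * (α₁ * (b₂ - α₂)) :=
    mul_le_mul_of_nonneg_right hα0 (mul_nonneg (e0'.trans e0) (sub_nonneg.2 h2))
  have e4 : 2 * ((306 / 1000 - E) * (8 / 27)) - 1000 / 256 * (φ * E) ≤ α₁ * (b₂ + α₂) := by
    rw [← hφ]
    linarith only [e2, e3]
  have e5 := mul_le_mul_of_nonneg_right e4 hφ0
  linarith only [e1, e5]

lemma exists_gapPoint_four {b₁ b₂ b₃ α₁ α₂ : ℝ} (hb1 : 306 / 1000 ≤ b₁) (hb1' : b₁ ≤ 31 / 100)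
    (hb2 : 8 / 27 ≤ b₂) (hb2' : b₂ ≤ 31 / 100) (hb3 : 1 / 4 ≤ b₃) (h : α₁ ≤ b₁)
    (h' : b₁ - α₁ ≤ 1 / 20) (h20 : 0 ≤ α₂) (h2 : α₂ ≤ b₂)
    (hψ : α₁ ^ 2 * (b₂ - α₂) ≤ 16 / 25 * (b₁ - α₁)) :
    ∃ x, GapPoint b₁ b₂ b₃ α₁ α₂ x := by
  obtain ⟨φ, hφ0, hφ1, hφ⟩ := exists_mul_eq
    (mul_nonneg (sq_nonneg α₁) (sub_nonneg.2 h2)) hψ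
  obtain ⟨E, hE⟩ : ∃ E, E = b₁ - α₁ := ⟨_, rfl⟩
  rw [← hE] at h' hφ
  have hE0 : 0 ≤ E := by linarith only [hE, h]
  obtain ⟨x, hx⟩ : ∃ x, x = 711 / 1000 - 3 / 2 * E + 17 / 10 * φ * E := ⟨_, rfl⟩
  have hφE := mul_nonneg hφ0 hE0
  have hφE' := mul_le_mul_of_nonneg_right hφ1 hE0
  have hφE'' := mul_le_mul_of_nonneg_left h' hφ0
  have hxl : 3 / 5 ≤ x := by linarith only [hx, hφE, h']
  have hxu : x ≤ 3 / 4 := by linarith only [hx, hφE', hE0]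
  have hx0 : 0 ≤ x := by linarith only [hxl]
  have hα0 : 0 ≤ α₁ := by linarith only [hE, hb1, h']
  have hK : (2 * b₁ - E) * b₂ + φ ≤ (62 / 100 - E) * (31 / 100) + φ := by
    have := mul_le_mul (show 2 * b₁ - E ≤ 62 / 100 - E by linarith only [hb1']) hb2'
      (by linarith only [hb2]) (by linarith only [h'])
    linarith only [this]
  have hK' : (62 / 100 - E) * (31 / 100) + φ ≤ 833 / 1000 := by linarith only [hE0, hφ1]
  have hC0 : 0 ≤ (b₁ ^ 2 + b₁ * α₁ + α₁ ^ 2) * b₂ ^ 2 + α₁ * (b₂ + α₂) * φ := by positivity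
  have hD : 17 / 10000 + 215 / 10000 * φ - 38 / 100 * E * φ ≤
      23 / 25 * b₃ * ((b₁ ^ 2 + b₁ * α₁ + α₁ ^ 2) * b₂ ^ 2 + α₁ * (b₂ + α₂) * φ) * x ^ 2 := by
    refine (quadratic_term_four hE0 h' hφ0 hφ1 hx).trans
      (mul_le_mul_of_nonneg_right ?_ (sq_nonneg x))
    have e1 := mul_le_mul_of_nonneg_right hb3 hC0
    have e2 := quadratic_coeff_ge hb1 hb2 h2 hE h' hφ0 hφ
    linarith only [e1, e2]
  have hS : 0 ≤ 1 - ((62 / 100 - E) * (31 / 100) + φ) * x +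
      (17 / 10000 + 215 / 10000 * φ - 38 / 100 * E * φ) := by
    have := mul_le_mul hK' hxu hx0 (by norm_num)
    linarith only [this, hφE'', hφ0]
  refine ⟨x, gapPoint_of_bounds hE hφ hE0 hxl hxu (hK.trans hK')
    (mul_nonneg (by linarith only [hb3]) hC0) ?_
    ((gap_bound_four hE0 h' hφ0 hφ1 hx).trans ?_)⟩
  · have e0 := derivative_bound_four hE0 h' hφ0 hφ1 hx
    have e1 := derivative_bound_mono (α := α₁) (b := 31 / 100) h' (L := 306 / 1000) (by norm_num)
      (by linarith only [hE, hb1']) (by linarith only [hE, hb1]) hE0 le_rfl (by norm_num) (x := x)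
      (by linarith only [hxl]) (by linarith only [hxu])
    have e2 : α₁ ^ 2 * b₂ * x ^ 3 ≤ α₁ ^ 2 * (31 / 100) * x ^ 3 := by gcongr
    linarith only [e0, e1, e2]
  · refine (mul_le_mul_of_nonneg_right (tangent_le_cube hx0) hS).trans
      (mul_le_mul_of_nonneg_left ?_ (by positivity))
    have := mul_le_mul_of_nonneg_right hK hx0
    linarith only [this, hD]

/-- A sampling point bounds from below the difference of the maxima defined by two ratio
sequences. -/
lemma GapPoint.le_sub {σ τ : ℕ → ℝ} {x₁ : ℝ} (hg : GapPoint (τ 0) (τ 1) (τ 2) (σ 0) (σ 1) x₁)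
    (h0 : ∀ k, 0 ≤ σ k) (h : ∀ k, σ k ≤ τ k) (hτ31 : ∀ k, τ k ≤ 31 / 100)
    (hcontr : ∀ k, σ k ^ 2 * (τ (k + 1) - σ (k + 1)) ≤ 16 / 25 * (τ k - σ k)) {m : ℕ} {x β : ℝ}
    (hx : 0 < x) (hx' : x ≤ 15 / 16)
    (hβ : ∀ y, 1 / 2 ≤ y → y ≤ 19 / 20 → y * altSum τ y (m + 6) ≤ β) :
    (τ 0 - σ 0) * (1502 / 10000 - 133 / 1000 * (τ 0 - σ 0)) ≤ β - x * altSum σ x (m + 6) := by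
  obtain ⟨hl, hu, hder, hgap⟩ := hg
  obtain ⟨y, hy, hy', hxy⟩ : ∃ y, x₁ ≤ y ∧ y ≤ 15 / 16 ∧
      x * altSum σ x (m + 6) ≤ y * altSum σ y (m + 6) := by
    rcases le_total x₁ x with hc | hc
    · exact ⟨x, hc, hx', le_rfl⟩
    · exact ⟨x₁, le_rfl, hu, mul_altSum_le h0
        (fun k => ((h k).trans (hτ31 k)).trans (by norm_num)) hx.le hc (by linarith) hder (m + 2)⟩
  have h1 := hgap y hy hy'
  have h2 := mul_le_mul_of_nonneg_left
    (altSum_sub_ge h0 h hτ31 hcontr (show 0 ≤ y by linarith) (by linarith) m)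
    (show 0 ≤ y by linarith)
  have h3 := hβ y (by linarith) (by linarith)
  linarith

lemma cubic_le {c x : ℝ} (hc : 0 ≤ c) (hc' : c ≤ 26 / 100) (hx' : x ≤ 15 / 16) :
    x * (1 - x + c * x ^ 2) ≤ 1 / 4 + 19 / 100 * c := by
  have h1 : 0 ≤ 1 / 4 - x + x ^ 2 := by linarith [sq_nonneg (x - 1 / 2)]
  have h2 : 0 ≤ 2994 / 10000 - x + x ^ 2 - 26 / 100 * x ^ 3 := by
    have c := sq_nonneg (x - 6807 / 10000)
    linarith [c, mul_nonneg (sub_nonneg.2 hx') c]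
  linarith [mul_nonneg (sub_nonneg.2 hc') h1, mul_nonneg hc h2]

/-- The contraction inequality, deduced from a lower bound on the new gap. -/
lemma contraction_of_gap {α β E : ℝ} (hα : 0 ≤ α) (hβ : β ≤ 31 / 100) (hE : 0 ≤ E)
    (h : (E ≤ 1 / 20 ∧ E * (1502 / 10000 - 133 / 1000 * E) ≤ β - α) ∨
      (1 / 20 ≤ E ∧ 15 / 100 * E ≤ β - α)) :
    α ≤ β ∧ α ^ 2 * E ≤ 16 / 25 * (β - α) := by
  rcases h with ⟨h1, h2⟩ | ⟨h1, h2⟩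
  · have h3 : 14 / 100 * E ≤ E * (1502 / 10000 - 133 / 1000 * E) := by nlinarith
    refine ⟨by linarith, ?_⟩
    have h4 : α ^ 2 ≤ (31 / 100 - 14 / 100 * E) ^ 2 := by gcongr; linarith
    have h5 : (31 / 100 - 14 / 100 * E) ^ 2 ≤
        16 / 25 * (1502 / 10000 - 133 / 1000 * E) := by nlinarith
    have := mul_le_mul_of_nonneg_right (h4.trans h5) hE
    linarith
  · refine ⟨by linarith, ?_⟩
    have h4 : α ^ 2 ≤ (3025 / 10000) ^ 2 := by gcongr; linarith
    have := mul_le_mul_of_nonneg_right h4 hE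
    linarith

lemma SectionHyperbolic.mono {a : ℕ → ℝ} {m n : ℕ} (h : SectionHyperbolic a n) (hmn : m ≤ n) :
    SectionHyperbolic a m :=
  ⟨fun i hi => h.1 i (hi.trans hmn), fun i h1 h2 => h.2 i h1 (h2.trans hmn)⟩

lemma ratio_nonneg {a : ℕ → ℝ} {m : ℕ} (ha : ∀ j ≤ m + 1, 0 < a j) : 0 ≤ ratio a m := by
  cases m with
  | zero => exact le_rfl
  | succ m => exact (ratio_pos ha).le

/-- Sampling points exist for the comparison with the extremal ratios. -/
lemma exists_gapPoint_Acoef {N : ℕ} (hN : 1 ≤ N) {s : ℕ → ℝ} (hs : ∀ m ≤ N, 0 ≤ s m)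
    (hle : ∀ m ≤ N, s m ≤ ratio Acoef m)
    (hcontr : s N ^ 2 * (ratio Acoef (N - 1) - s (N - 1)) ≤ 16 / 25 * (ratio Acoef N - s N))
    (hE : ratio Acoef N - s N ≤ 1 / 20) :
    ∃ x, GapPoint (ratio Acoef N) (ratio Acoef (N - 1)) (ratio Acoef (N - 2)) (s N)
      (s (N - 1)) x := by
  have hr := fun m (hm : 1 ≤ m) => ratioBound_Acoef hm
  have hr0 : ratio Acoef 0 = 0 := rfl
  have hN0 := hle N le_rfl
  have hN1 := hle (N - 1) (by omega)
  rcases (show N = 1 ∨ N = 2 ∨ 3 ≤ N by omega) with rfl | rfl | h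
  · have hs0 : s 0 = 0 := le_antisymm (hle 0 (by omega)) (hs 0 (by omega))
    have e1 := (hr 1 le_rfl).one rfl
    rw [e1] at hE hN0 ⊢
    simp only [Nat.sub_self, Nat.reduceSub, hr0, hs0]
    exact ⟨_, gapPoint_two hN0 hE⟩
  · have e1 := (hr 1 le_rfl).one rfl
    have e2 := (hr 2 (by omega)).two rfl
    simp only [Nat.sub_self, Nat.add_one_sub_one, hr0, e1, e2] at *
    exact exists_gapPoint_three hN0 hE hN1 hcontr
  · have b1 := (hr (N - 1) (by omega)).bounds (by omega)
    exact exists_gapPoint_four ((hr N hN).bounds_of_three_le h) ((hr N hN).bounds hN).2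
      ((hr (N - 1) (by omega)).bounds_of_two_le (by omega)) b1.2
      ((hr (N - 2) (by omega)).bounds (by omega)).1 hN0 hE (hs _ (by omega)) hN1 hcontr

/-- The extremal ratios grow slowly enough for the crude estimate of `cubic_le` to suffice. -/
lemma ratio_Acoef_succ_ge {N : ℕ} (hN : 1 ≤ N) :
    248 / 1000 + 19 / 100 * ratio Acoef N ≤ ratio Acoef (N + 1) := by
  have h1 := ratioBound_Acoef hN
  have h2 := ratioBound_Acoef (show 1 ≤ N + 1 by omega)
  rcases (show N = 1 ∨ N = 2 ∨ 3 ≤ N by omega) with rfl | rfl | h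
  · rw [h1.one rfl, h2.two rfl]
    norm_num
  · rw [h1.two rfl]
    linarith [(h2.three rfl).1]
  · linarith [(h1.bounds hN).2, (h2.four (by omega)).1]

/-- The ratios of a section-hyperbolic polynomial are bounded by the extremal ones, with defects
that grow in a controlled way. -/
lemma SectionHyperbolic.ratio_le {a : ℕ → ℝ} {n : ℕ} (ha : SectionHyperbolic a (n + 1)) :
    ratio a n ≤ ratio Acoef n ∧
      ratio a n ^ 2 * (ratio Acoef (n - 1) - ratio a (n - 1)) ≤
        16 / 25 * (ratio Acoef n - ratio a n) := by
  induction n using Nat.strong_induction_on with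
  | _ n ih =>
  have hr0 : ∀ b, ratio b 0 = 0 := fun _ => rfl
  rcases (show n = 0 ∨ n = 1 ∨ ∃ N, 1 ≤ N ∧ n = N + 1 from by
    rcases n with _ | _ | N
    · simp
    · simp
    · exact Or.inr (Or.inr ⟨N + 1, by omega, rfl⟩)) with rfl | rfl | ⟨N, hN, rfl⟩
  · simp [hr0]
  · have h1 := ((ha.2 2 (by omega) le_rfl).ratio_bounds (n := 0) ha.1).1
    have h2 := (ratioBound_Acoef le_rfl).one rfl
    rw [hr0] at h1
    simp only [Nat.sub_self, hr0, h2]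
    norm_num at h1 ⊢
    linarith
  have hIH : ∀ m ≤ N, _ := fun m hm => ih m (by omega) (ha.mono (by omega))
  have hnn : ∀ m ≤ N + 1, 0 ≤ ratio a m := fun m hm => ratio_nonneg fun j hj => ha.1 j (by omega)
  have hA : ∀ m, ratio Acoef m ≤ 31 / 100 := by
    intro m
    rcases Nat.eq_zero_or_pos m with rfl | h
    · rw [hr0]; norm_num
    · exact ((ratioBound_Acoef h).bounds h).2
  set σ := downRatio (ratio a) (N + 1) with hσ
  set τ := downRatio (ratio Acoef) (N + 1) with hτ
  have h0 : ∀ k, 0 ≤ σ k := fun k => hnn _ (by omega)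
  have hle : ∀ k, σ k ≤ τ k := fun k => (hIH _ (by omega)).1
  have hτ31 : ∀ k, τ k ≤ 31 / 100 := fun k => hA _
  have hcontr : ∀ k, σ k ^ 2 * (τ (k + 1) - σ (k + 1)) ≤ 16 / 25 * (τ k - σ k) := fun k =>
    (hIH (N + 1 - 1 - k) (by omega)).2
  obtain ⟨x, hx0, hx1, hxr⟩ := ((ha.2 (N + 2) (by omega) le_rfl).exists_root ha.1
    ((hIH N le_rfl).1.trans (hA N))).2
  have hN0 := (hIH N le_rfl).1
  refine contraction_of_gap (hnn _ le_rfl) (hA _) (sub_nonneg.2 hN0) ?_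
  rcases le_total (ratio Acoef N - ratio a N) (1 / 20) with hE | hE
  · obtain ⟨x₁, hg⟩ := exists_gapPoint_Acoef hN (fun m hm => hnn m (by omega))
      (fun m hm => (hIH m hm).1) (hIH N le_rfl).2 hE
    refine Or.inl ⟨hE, ?_⟩
    rw [hxr]
    exact GapPoint.le_sub (σ := σ) (τ := τ) (m := N + 1) hg h0 hle hτ31 hcontr hx0 hx1
      fun y => mul_altSum_le_ratio_Acoef hN
  · refine Or.inr ⟨hE, ?_⟩
    have hb := (altSum_bounds h0 (fun k => ((hle k).trans (hτ31 k)).trans (by norm_num)) hx0.le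
      (by linarith) (N + 3)).2
    have hb' : altSum σ x (N + 7) ≤ 1 - x + ratio a N * x ^ 2 := by
      have e1 : σ 0 * σ 1 * σ 2 * x ≤ 1 * 1 * 1 * 1 := by
        have h1 : ∀ k, σ k ≤ 1 := fun k => ((hle k).trans (hτ31 k)).trans (by norm_num)
        have := h0 0
        have := h0 1
        have := h0 2
        gcongr
        · exact h1 0
        · exact h1 1
        · exact h1 2
        · linarith
      have e2 := mul_le_mul_of_nonneg_left e1
        (show 0 ≤ σ 0 ^ 2 * σ 1 * x ^ 3 from mul_nonneg (mul_nonneg (sq_nonneg _) (h0 1))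
          (by positivity))
      have e3 : σ 0 = ratio a N := rfl
      rw [← e3]
      linarith only [hb, e2]
    have h1 := mul_le_mul_of_nonneg_left hb' hx0.le
    rw [← hxr] at h1
    have h2 := cubic_le (hnn N (by omega)) (by linarith [hA N]) hx1
    have h3 := ratio_Acoef_succ_ge hN
    simp only [Nat.add_sub_cancel]
    linarith

lemma div_le_div_of_ratio_le {a b : ℕ → ℝ} {j : ℕ} (ha : ∀ i ≤ j + 2, 0 < a i)
    (h : ratio a (j + 1) ≤ ratio b (j + 1)) :
    b (j + 1) ^ 2 / (b j * b (j + 2)) ≤ a (j + 1) ^ 2 / (a j * a (j + 2)) := by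
  have := inv_anti₀ (ratio_pos ha) h
  rwa [ratio, ratio, inv_div, inv_div] at this

/-- Every section-hyperbolic polynomial of degree `i+1` satisfies
`a_i^2/(a_{i-1} a_{i+1}) ≥ A_i^2/(A_{i-1} A_{i+1})`, and the bound is attained at the
section-hyperbolic polynomial `p_{i+1}(x) = Σ_{j=0}^{i+1} A_j x^j`; hence the infimum `m_i`
equals `A_i^2/(A_{i-1} A_{i+1})`. -/
theorem stmt3 (i : ℕ) (hi : 1 ≤ i) :
    (∀ a : ℕ → ℝ, SectionHyperbolic a (i + 1) →
      a i ^ 2 / (a (i - 1) * a (i + 1)) ≥ Acoef i ^ 2 / (Acoef (i - 1) * Acoef (i + 1))) ∧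
    SectionHyperbolic Acoef (i + 1) := by
  obtain ⟨j, rfl⟩ : ∃ j, i = j + 1 := ⟨i - 1, by omega⟩
  obtain ⟨hpos, hhyp, -⟩ := Acoef_properties (j + 1)
  exact ⟨fun a ha => div_le_div_of_ratio_le ha.1 ha.ratio_le.1, hpos, hhyp⟩
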